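/- arXiv:2502.17145 — 7 statements merged into one kernel-verified Lean document; each statement's English description precedes it below -/
import Mathlib

section
/- Let p ≤ q be coprime positive integers and θ = arctan(p/q). Then the measure μ_θ is singular with respect to Lebesgue measure on ℝ (μ_θ and Lebesgue measure are mutually singular). -/
open MeasureTheory

open Filter Topology Complex

/-- The characteristic function of an absolutely continuous measure vanishes at infinity. -/
lemma tendsto_charFun_atTop_of_absolutelyContinuous {ν : Measure ℝ} [IsFiniteMeasure ν]
    (hν : ν ≪ volume) : Tendsto (charFun ν) atTop (𝓝 0) := by
  have hRL := Real.tendsto_integral_exp_smul_cocompact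
    (fun x : ℝ => (((ν.rnDeriv volume x).toReal : ℝ) : ℂ))
  have hlin : Tendsto (fun t : ℝ => -(2 * Real.pi)⁻¹ * t) atTop (cocompact ℝ) :=
    (tendsto_id.const_mul_atTop_of_neg (by have := Real.pi_pos; simp; positivity)).mono_right
      atBot_le_cocompact
  refine (hRL.comp hlin).congr fun t => ?_
  conv_rhs => rw [← Measure.withDensity_rnDeriv_eq ν volume hν]
  rw [charFun_apply_real, integral_withDensity_eq_integral_toReal_smul
    (Measure.measurable_rnDeriv _ _) (Measure.rnDeriv_lt_top _ _)]
  refine integral_congr_ae (Eventually.of_forall fun x => ?_)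
  simp only [Circle.smul_def, Real.fourierChar_apply, smul_eq_mul, real_smul]
  rw [mul_comm]
  congr 2
  have : (Real.pi : ℂ) ≠ 0 := by exact_mod_cast Real.pi_ne_zero
  push_cast
  field_simp

lemma charFun_add_measure {μ ν : Measure ℝ} [IsFiniteMeasure μ] [IsFiniteMeasure ν] (t : ℝ) :
    charFun (μ + ν) t = charFun μ t + charFun ν t := by
  simp only [charFun_eq_integral_innerProbChar]
  exact integral_add_measure (BoundedContinuousFunction.integrable _ _)
    (BoundedContinuousFunction.integrable _ _)

/-- The average of the push-forwards of a measure under `x ↦ (x + d) / 2`, for the digits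
`d = 0, 1, r`. -/
noncomputable def digitAverage (r : ℝ) (ν : Measure ℝ) : Measure ℝ :=
  (3⁻¹ : ENNReal) • (ν.map (fun x => 2⁻¹ * (x + 0)) + ν.map (fun x => 2⁻¹ * (x + 1))
    + ν.map (fun x => 2⁻¹ * (x + r)))

lemma map_half_add_volume (d : ℝ) :
    (volume : Measure ℝ).map (fun x => 2⁻¹ * (x + d)) = (2 : ENNReal) • volume := by
  have h : (fun x : ℝ => 2⁻¹ * (x + d)) = (fun x => 2⁻¹ * x) ∘ (fun x => x + d) := rfl
  rw [h, ← Measure.map_map (by fun_prop) (by fun_prop), map_add_right_eq_self,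
    Real.map_volume_mul_left (by norm_num)]
  simp

lemma absolutelyContinuous_map_half_add {ν : Measure ℝ} (hν : ν ≪ volume) (d : ℝ) :
    ν.map (fun x => 2⁻¹ * (x + d)) ≪ volume := by
  refine (hν.map (by fun_prop)).trans ?_
  rw [map_half_add_volume]
  exact Measure.smul_absolutelyContinuous

lemma mutuallySingular_map_half_add {ν : Measure ℝ} (hν : ν.MutuallySingular volume) (d : ℝ) :
    (ν.map (fun x => 2⁻¹ * (x + d))).MutuallySingular volume := by
  have he : MeasurableEmbedding (fun x : ℝ => 2⁻¹ * (x + d)) :=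
    (measurableEmbedding_mulLeft₀ (by norm_num)).comp (measurableEmbedding_addRight d)
  refine (he.mutuallySingular_map hν).mono_ac Measure.AbsolutelyContinuous.rfl ?_
  rw [map_half_add_volume]
  exact Measure.absolutelyContinuous_smul (by norm_num)

lemma absolutelyContinuous_digitAverage {ν : Measure ℝ} (hν : ν ≪ volume) (r : ℝ) :
    digitAverage r ν ≪ volume :=
  Measure.AbsolutelyContinuous.smul_left
    (((absolutelyContinuous_map_half_add hν 0).add_left
      (absolutelyContinuous_map_half_add hν 1)).add_left
        (absolutelyContinuous_map_half_add hν r)) _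

lemma mutuallySingular_digitAverage {ν : Measure ℝ} (hν : ν.MutuallySingular volume) (r : ℝ) :
    (digitAverage r ν).MutuallySingular volume :=
  (((mutuallySingular_map_half_add hν 0).add_left (mutuallySingular_map_half_add hν 1)).add_left
    (mutuallySingular_map_half_add hν r)).smul _

lemma digitAverage_add (r : ℝ) (μ ν : Measure ℝ) :
    digitAverage r (μ + ν) = digitAverage r μ + digitAverage r ν := by
  unfold digitAverage
  rw [Measure.map_add _ _ (by fun_prop), Measure.map_add _ _ (by fun_prop),
    Measure.map_add _ _ (by fun_prop), ← smul_add]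
  congr 1
  abel

instance isFiniteMeasure_digitAverage (r : ℝ) (ν : Measure ℝ) [IsFiniteMeasure ν] :
    IsFiniteMeasure (digitAverage r ν) :=
  Measure.smul_finite _ (by norm_num)

/-- The absolutely continuous part of a fixed point of `digitAverage r` is a fixed point. -/
lemma digitAverage_withDensity_rnDeriv {r : ℝ} {μ : Measure ℝ} [IsFiniteMeasure μ]
    (hμ : digitAverage r μ = μ) :
    digitAverage r (volume.withDensity (μ.rnDeriv volume))
      = volume.withDensity (μ.rnDeriv volume) := by
  set a := volume.withDensity (μ.rnDeriv volume) with ha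
  have hdec : μ = digitAverage r (μ.singularPart volume) + digitAverage r a := by
    rw [← digitAverage_add, ← Measure.haveLebesgueDecomposition_add μ volume, hμ]
  have hfin : IsFiniteMeasure a := isFiniteMeasure_of_le μ (Measure.withDensity_rnDeriv_le _ _)
  have hac := Measure.withDensity_rnDeriv_eq (digitAverage r a) volume
    (absolutelyContinuous_digitAverage (withDensity_absolutelyContinuous _ _) r)
  rw [← hac] at hdec ⊢
  exact Measure.eq_withDensity_rnDeriv (Measure.measurable_rnDeriv _ _)
    (mutuallySingular_digitAverage (Measure.mutuallySingular_singularPart _ _) r) hdec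

lemma charFun_map_half_add (ν : Measure ℝ) (d t : ℝ) :
    charFun (ν.map (fun x => 2⁻¹ * (x + d))) t
      = charFun ν (2⁻¹ * t) * cexp (d * (2⁻¹ * t : ℝ) * I) := by
  rw [charFun_map_mul_comp (by fun_prop), charFun_map_add_const]
  simp [mul_comm]

lemma charFun_digitAverage (r : ℝ) (ν : Measure ℝ) [IsFiniteMeasure ν] (t : ℝ) :
    charFun (digitAverage r ν) (2 * t)
      = 3⁻¹ * (1 + cexp (t * I) + cexp (r * t * I)) * charFun ν t := by
  have h : (2 : ℝ)⁻¹ * (2 * t) = t := by ring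
  rw [digitAverage, charFun_apply, integral_smul_measure, ← charFun_apply, charFun_add_measure,
    charFun_add_measure, charFun_map_half_add, charFun_map_half_add, charFun_map_half_add, h]
  simp
  ring

/-- If `1 + z + w = 0` with `z`, `w` on the unit circle, then `z` is a primitive cube root of
unity. -/
lemma sq_add_self_add_one_eq_zero {z w : ℂ} (hz : ‖z‖ = 1) (hw : ‖w‖ = 1)
    (h : 1 + z + w = 0) : z ^ 2 + z + 1 = 0 := by
  have hz' : z * (starRingEnd ℂ) z = 1 := by rw [mul_conj, normSq_eq_norm_sq, hz]; simp
  have hw' : w * (starRingEnd ℂ) w = 1 := by rw [mul_conj, normSq_eq_norm_sq, hw]; simp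
  have hc : 1 + (starRingEnd ℂ) z + (starRingEnd ℂ) w = 0 := by
    simpa using congrArg (starRingEnd ℂ) h
  linear_combination (-z * w) * hc + w * hz' + z * hw' + (1 + z) * h

/-- A root of unity of order a power of `2`, a complex number of modulus one and `1` do not sum to
zero. -/
lemma one_add_add_ne_zero {z w : ℂ} {n : ℕ} (hz : z ^ 2 ^ n = 1) (hw : ‖w‖ = 1) :
    1 + z + w ≠ 0 := by
  intro h
  have h2 := sq_add_self_add_one_eq_zero
    (norm_eq_one_of_pow_eq_one hz (by positivity)) hw h
  have h3 : z ^ 3 = 1 := by linear_combination (z - 1) * h2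
  have hcop : Nat.Coprime 3 (2 ^ n) := Nat.Coprime.pow_right _ (by norm_num)
  have hz1 : z = 1 := by
    have := orderOf_dvd_of_pow_eq_one h3
    have h' := orderOf_dvd_of_pow_eq_one hz
    exact orderOf_eq_one_iff.1 (Nat.eq_one_of_dvd_coprimes hcop this h')
  rw [hz1] at h2
  norm_num at h2

/-- An absolutely continuous finite fixed point of `digitAverage (p / q)` vanishes. -/
lemma eq_zero_of_digitAverage_eq {p q : ℕ} (hq : 0 < q) {ν : Measure ℝ} [IsFiniteMeasure ν]
    (hν : ν ≪ volume) (hfix : digitAverage ((p : ℝ) / q) ν = ν) : ν = 0 := by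
  have hq' : (q : ℂ) ≠ 0 := by exact_mod_cast hq.ne'
  have hrec : ∀ t : ℝ, charFun ν (2 * t)
      = 3⁻¹ * (1 + cexp (t * I) + cexp (((p : ℝ) / q : ℝ) * t * I)) * charFun ν t := by
    intro t
    conv_lhs => rw [← hfix]
    exact charFun_digitAverage _ _ _
  have hup : ∀ n : ℕ, charFun ν (2 * Real.pi * q * 2 ^ n) = charFun ν (2 * Real.pi * q) := by
    intro n
    induction n with
    | zero => simp
    | succ n ih =>
      rw [show 2 * Real.pi * q * 2 ^ (n + 1) = 2 * (2 * Real.pi * q * 2 ^ n) by ring, hrec, ih]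
      have h1 : cexp ((2 * Real.pi * q * 2 ^ n : ℝ) * I) = 1 :=
        Complex.exp_eq_one_iff.2 ⟨q * 2 ^ n, by push_cast; ring⟩
      have h2 : cexp (((p : ℝ) / q : ℝ) * (2 * Real.pi * q * 2 ^ n : ℝ) * I) = 1 :=
        Complex.exp_eq_one_iff.2 ⟨p * 2 ^ n, by push_cast; field_simp⟩
      rw [h1, h2]
      ring
  have hzero : charFun ν (2 * Real.pi * q) = 0 := by
    have htop : Tendsto (fun n : ℕ => 2 * Real.pi * q * (2 : ℝ) ^ n) atTop atTop :=
      (tendsto_pow_atTop_atTop_of_one_lt one_lt_two).const_mul_atTop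
        (by have := Real.pi_pos; positivity)
    have := (tendsto_charFun_atTop_of_absolutelyContinuous hν).comp htop
    exact tendsto_nhds_unique (tendsto_const_nhds.congr fun n => (hup n).symm) this
  have hdown : ∀ n : ℕ, charFun ν (2 * Real.pi * q * (1 / 2) ^ n) = 0 := by
    intro n
    induction n with
    | zero => simpa using hzero
    | succ n ih =>
      rw [show 2 * Real.pi * q * (1 / 2) ^ n = 2 * (2 * Real.pi * q * (1 / 2) ^ (n + 1)) by ring,
        hrec] at ih
      refine (mul_eq_zero.1 ih).resolve_left (mul_ne_zero (by norm_num) ?_)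
      refine one_add_add_ne_zero (n := n + 1) ?_ ?_
      · rw [← Complex.exp_nat_mul]
        refine Complex.exp_eq_one_iff.2 ⟨q, ?_⟩
        have hpow : (2 : ℂ) ^ (n + 1) * (1 / 2) ^ (n + 1) = 1 := by
          rw [← mul_pow]; norm_num
        push_cast
        linear_combination (q * (2 * Real.pi * I)) * hpow
      · rw [← ofReal_mul, norm_exp_ofReal_mul_I]
  have hlim : Tendsto (fun n : ℕ => 2 * Real.pi * q * (1 / 2 : ℝ) ^ n) atTop (𝓝 0) := by
    simpa using (tendsto_pow_atTop_nhds_zero_of_lt_one (r := (1 / 2 : ℝ)) (by norm_num)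
      (by norm_num)).const_mul (2 * Real.pi * q)
  have h0 : charFun ν 0 = 0 :=
    tendsto_nhds_unique ((continuous_charFun.tendsto 0).comp hlim)
      (tendsto_const_nhds.congr fun n => (hdown n).symm)
  rw [charFun_zero] at h0
  exact Measure.measure_univ_eq_zero.1
    ((measureReal_eq_zero_iff (by finiteness)).1 (by exact_mod_cast h0))

/-- For coprime positive integers `p ≤ q` and `θ = arctan(p/q)`, the
self-similar measure `μ_θ` (characterized as the Borel probability measure satisfying
`μ_θ(A) = (1/3)(μ_θ(2A) + μ_θ(2A−1) + μ_θ(2A−p/q))`) is mutually singular with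
Lebesgue measure on `ℝ`. -/
theorem stmt_0 (p q : ℕ) (hp : 0 < p) (hq : 0 < q) (hpq : p ≤ q)
    (hcop : Nat.Coprime p q)
    (μ : Measure ℝ) (hprob : IsProbabilityMeasure μ)
    (hself : ∀ A : Set ℝ, MeasurableSet A →
      μ A = (1 / 3) * (μ ((fun x => 2 * x) '' A) + μ ((fun x => 2 * x - 1) '' A)
        + μ ((fun x => 2 * x - (p : ℝ) / (q : ℝ)) '' A))) :
    μ.MutuallySingular volume := by
  have himage : ∀ (d : ℝ) (A : Set ℝ),
      (fun x => 2⁻¹ * (x + d)) ⁻¹' A = (fun x => 2 * x - d) '' A := by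
    intro d A
    refine (congrFun (Set.image_eq_preimage_of_inverse (fun x => ?_) (fun x => ?_)) A).symm
    all_goals ring
  have hfix : digitAverage ((p : ℝ) / q) μ = μ := by
    ext A hA
    rw [hself A hA, digitAverage, Measure.smul_apply, Measure.add_apply, Measure.add_apply,
      Measure.map_apply (by fun_prop) hA, Measure.map_apply (by fun_prop) hA,
      Measure.map_apply (by fun_prop) hA, himage, himage, himage]
    simp
  have hfin : IsFiniteMeasure (volume.withDensity (μ.rnDeriv volume)) :=
    isFiniteMeasure_of_le μ (Measure.withDensity_rnDeriv_le _ _)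
  exact (Measure.withDensity_rnDeriv_eq_zero _ _).1 (eq_zero_of_digitAverage_eq hq
    (withDensity_absolutelyContinuous _ _) (digitAverage_withDensity_rnDeriv hfix))
end

section
/- Let p ≤ q be coprime positive integers. The finite state automaton (G,E)_{p/q} is strongly connected: for every pair of states a, b ∈ G there is a finite directed path of edges of E from a to b (i.e. b lies in the reflexive–transitive closure of the edge relation started at a). -/
/-- A lattice point of the hexagon of radius `2 * N + 1` is twice a lattice point of the hexagon of
radius `N` plus one of the seven lattice points of the unit hexagon. -/
theorem exists_hexagon_digit {N X Y : ℤ} (hX : |X| ≤ 2 * N + 1) (hY : |Y| ≤ 2 * N + 1)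
    (hXY : |X + Y| ≤ 2 * N + 1) :
    ∃ X' Y' x y : ℤ, X = 2 * X' + x ∧ Y = 2 * Y' + y ∧
      |X'| ≤ N ∧ |Y'| ≤ N ∧ |X' + Y'| ≤ N ∧ |x| ≤ 1 ∧ |y| ≤ 1 ∧ |x + y| ≤ 1 := by
  simp only [abs_le] at *
  have of_digit (x y : ℤ) (hx : (X - x) % 2 = 0) (hy : (Y - y) % 2 = 0)
      (h : (-(2 * N) ≤ X - x ∧ X - x ≤ 2 * N) ∧ (-(2 * N) ≤ Y - y ∧ Y - y ≤ 2 * N) ∧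
        (-(2 * N) ≤ X + Y - x - y ∧ X + Y - x - y ≤ 2 * N))
      (hxy : (-1 ≤ x ∧ x ≤ 1) ∧ (-1 ≤ y ∧ y ≤ 1) ∧ (-1 ≤ x + y ∧ x + y ≤ 1)) :
      ∃ X' Y' x y : ℤ, X = 2 * X' + x ∧ Y = 2 * Y' + y ∧
        (-N ≤ X' ∧ X' ≤ N) ∧ (-N ≤ Y' ∧ Y' ≤ N) ∧ (-N ≤ X' + Y' ∧ X' + Y' ≤ N) ∧
        (-1 ≤ x ∧ x ≤ 1) ∧ (-1 ≤ y ∧ y ≤ 1) ∧ (-1 ≤ x + y ∧ x + y ≤ 1) :=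
    ⟨(X - x) / 2, (Y - y) / 2, x, y, by omega⟩
  rcases Int.emod_two_eq_zero_or_one X with h₁ | h₁ <;>
    rcases Int.emod_two_eq_zero_or_one Y with h₂ | h₂
  · exact of_digit 0 0 (by omega) (by omega) (by omega) (by omega)
  · by_cases h : Y = 2 * N + 1 ∨ X + Y = 2 * N + 1
    · exact of_digit 0 1 (by omega) (by omega) (by omega) (by omega)
    · exact of_digit 0 (-1) (by omega) (by omega) (by omega) (by omega)
  · by_cases h : X = 2 * N + 1 ∨ X + Y = 2 * N + 1
    · exact of_digit 1 0 (by omega) (by omega) (by omega) (by omega)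
    · exact of_digit (-1) 0 (by omega) (by omega) (by omega) (by omega)
  · by_cases h : X = 2 * N + 1 ∨ Y = -(2 * N + 1)
    · exact of_digit 1 (-1) (by omega) (by omega) (by omega) (by omega)
    · exact of_digit (-1) 1 (by omega) (by omega) (by omega) (by omega)

/-- A state `b = 2 ^ n * a + X * q + Y * p` is reachable from `a` whenever `(X, Y)` lies in the
hexagon of radius `2 ^ n - 1`. -/
theorem reflTransGen_of_hexagon {p q : ℕ} (hpq : p ≤ q) (a : ℤ) (n : ℕ) {X Y b : ℤ}
    (hX : |X| ≤ 2 ^ n - 1) (hY : |Y| ≤ 2 ^ n - 1) (hXY : |X + Y| ≤ 2 ^ n - 1)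
    (hb : |b| ≤ (q : ℤ) - 1) (hab : b = 2 ^ n * a + X * q + Y * p) :
    Relation.ReflTransGen
      (fun u v : ℤ => |u| ≤ (q : ℤ) - 1 ∧ |v| ≤ (q : ℤ) - 1 ∧
        v - 2 * u ∈ ({0, (q : ℤ), -(q : ℤ), (p : ℤ), -(p : ℤ),
          (p : ℤ) - (q : ℤ), (q : ℤ) - (p : ℤ)} : Set ℤ))
      a b := by
  induction n generalizing X Y b with
  | zero =>
    obtain rfl : X = 0 := by simpa using hX
    obtain rfl : Y = 0 := by simpa using hY
    obtain rfl : b = a := by simpa using hab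
    exact .refl
  | succ n ih =>
    have hpow : (2 : ℤ) ^ (n + 1) - 1 = 2 * (2 ^ n - 1) + 1 := by ring
    rw [hpow] at hX hY hXY
    obtain ⟨X', Y', x, y, rfl, rfl, hX', hY', hXY', hx, hy, hxy⟩ :=
      exists_hexagon_digit hX hY hXY
    set c : ℤ := 2 ^ n * a + X' * q + Y' * p with hc
    have hbc : b - 2 * c = x * q + y * p := by rw [hab, hc]; ring
    have hmem : b - 2 * c ∈ ({0, (q : ℤ), -(q : ℤ), (p : ℤ), -(p : ℤ),
        (p : ℤ) - (q : ℤ), (q : ℤ) - (p : ℤ)} : Set ℤ) := by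
      rw [hbc]
      simp only [Set.mem_insert_iff, Set.mem_singleton_iff]
      rw [abs_le] at hx hy hxy
      obtain ⟨hx₁, hx₂⟩ := hx
      obtain ⟨hy₁, hy₂⟩ := hy
      interval_cases x <;> interval_cases y <;> omega
    have hcq : |c| ≤ (q : ℤ) - 1 := by
      simp only [Set.mem_insert_iff, Set.mem_singleton_iff] at hmem
      rw [abs_le] at hb ⊢
      omega
    exact (ih hX' hY' hXY' hcq hc).tail ⟨hcq, hb, hmem⟩

/-- For large `n`, some `(X, Y)` in the hexagon of radius `2 ^ n - 1` satisfies
`b = 2 ^ n * a + X * q + Y * p`. -/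
theorem exists_hexagon_coordinates {p q : ℕ} (hq : 0 < q) (hpq : p ≤ q)
    (hcop : Nat.Coprime p q) {a b : ℤ}
    (ha : |a| ≤ (q : ℤ) - 1) (hb : |b| ≤ (q : ℤ) - 1) :
    ∃ (n : ℕ) (X Y : ℤ), |X| ≤ 2 ^ n - 1 ∧ |Y| ≤ 2 ^ n - 1 ∧ |X + Y| ≤ 2 ^ n - 1 ∧
      b = 2 ^ n * a + X * q + Y * p := by
  obtain ⟨n, hn⟩ : ∃ n : ℕ, 2 * (q : ℤ) + 2 * q ^ 2 ≤ 2 ^ n :=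
    ⟨2 * q + 2 * q ^ 2, by exact_mod_cast Nat.lt_two_pow_self.le⟩
  have hq' : (0 : ℤ) < q := by exact_mod_cast hq
  have hp' : (p : ℤ) ≤ q := by exact_mod_cast hpq
  obtain ⟨r, s, hrs⟩ : IsCoprime (p : ℤ) q := Nat.isCoprime_iff_coprime.2 hcop
  set t : ℤ := b - 2 ^ n * a with ht
  set Y : ℤ := (t * r) % q with hYdef
  have hY₀ : 0 ≤ Y := Int.emod_nonneg _ hq'.ne'
  have hY₁ : Y < q := Int.emod_lt_of_pos _ hq'
  have hdiv : t * r = q * (t * r / q) + Y := (Int.mul_ediv_add_emod _ _).symm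
  obtain ⟨X, hXt⟩ : ∃ X : ℤ, t = X * q + Y * p :=
    ⟨t * s + (t * r / q) * p, by linear_combination p * hdiv - t * hrs⟩
  have hYp₀ : 0 ≤ Y * p := by positivity
  have hYp₁ : Y * p ≤ q * q := by gcongr
  rw [abs_le] at ha hb
  have hta₁ : 2 ^ n * a ≤ 2 ^ n * ((q : ℤ) - 1) := by gcongr; exact ha.2
  have hta₂ : 2 ^ n * (-((q : ℤ) - 1)) ≤ 2 ^ n * a := by gcongr; exact ha.1
  have hX₁ : X ≤ 2 ^ n - 1 - q := le_of_mul_le_mul_right (by linarith) hq'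
  have hX₂ : -(2 ^ n - 1 - q) ≤ X := le_of_mul_le_mul_right (by linarith) hq'
  have hqn : (q : ℤ) ≤ 2 ^ n - 1 := by nlinarith
  refine ⟨n, X, Y, ?_, ?_, ?_, by linarith⟩ <;> rw [abs_le] <;> constructor <;> linarith


/-- For coprime positive integers `p ≤ q`, the automaton `(G,E)_{p/q}`
with vertex set `G = {g : ℤ | |g| ≤ q - 1}` and edges `(a,b) ∈ E` iff `a, b ∈ G` and
`b - 2a ∈ {0, q, -q, p, -p, p - q, q - p}` is strongly connected: every state `b ∈ G`
is reachable from every state `a ∈ G` by a finite directed path of edges. -/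
theorem stmt_1 (p q : ℕ) (hp : 0 < p) (hq : 0 < q) (hpq : p ≤ q)
    (hcop : Nat.Coprime p q) (a b : ℤ)
    (ha : |a| ≤ (q : ℤ) - 1) (hb : |b| ≤ (q : ℤ) - 1) :
    Relation.ReflTransGen
      (fun u v : ℤ => |u| ≤ (q : ℤ) - 1 ∧ |v| ≤ (q : ℤ) - 1 ∧
        v - 2 * u ∈ ({0, (q : ℤ), -(q : ℤ), (p : ℤ), -(p : ℤ),
          (p : ℤ) - (q : ℤ), (q : ℤ) - (p : ℤ)} : Set ℤ))
      a b := by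
  obtain ⟨n, X, Y, hX, hY, hXY, hab⟩ := exists_hexagon_coordinates hq hpq hcop ha hb
  exact reflTransGen_of_hexagon hpq a n hX hY hXY hb hab
end

section
/- Let p ≤ q be coprime positive integers and θ = arctan(p/q). Then the dimension of μ_θ is strictly less than 1: there exist s < 1 and a Borel set A ⊆ ℝ with μ_θ(A) = 1 and Hausdorff dimension dim_H(A) ≤ s. -/
open MeasureTheory
open Filter Topology
open scoped ENNReal NNReal ComplexConjugate

/-- The Birkhoff sum of `cos (2π · - α)` along the first `N` points of the doubling orbit of `y`. -/
noncomputable def doublingCosSum (α : ℝ) (N : ℕ) (y : ℝ) : ℝ :=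
  ∑ i ∈ Finset.range N, Real.cos (2 * Real.pi * (2 ^ i * y) - α)

theorem doublingCosSum_succ (α : ℝ) (N : ℕ) (y : ℝ) :
    doublingCosSum α (N + 1) y
      = doublingCosSum α N (2 * y) + Real.cos (2 * Real.pi * y - α) := by
  unfold doublingCosSum
  rw [Finset.sum_range_succ']
  congr 1
  · refine Finset.sum_congr rfl fun i _ => ?_
    congr 1
    ring
  · simp

theorem doublingCosSum_add_intCast (α : ℝ) (N : ℕ) (y : ℝ) (k : ℤ) :
    doublingCosSum α N (y + k) = doublingCosSum α N y := by
  unfold doublingCosSum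
  refine Finset.sum_congr rfl fun i _ => ?_
  rw [← Real.cos_add_int_mul_two_pi (2 * Real.pi * (2 ^ i * y) - α) (2 ^ i * k)]
  congr 1
  push_cast
  ring

theorem continuous_doublingCosSum (α : ℝ) (N : ℕ) : Continuous (doublingCosSum α N) := by
  unfold doublingCosSum
  fun_prop

theorem abs_doublingCosSum_sub_le (α : ℝ) (N : ℕ) (x y : ℝ) :
    |doublingCosSum α N x - doublingCosSum α N y| ≤ 2 * Real.pi * ((2 ^ N - 1) * |x - y|) := by
  induction N generalizing x y with
  | zero => simp [doublingCosSum]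
  | succ N ih =>
    rw [doublingCosSum_succ, doublingCosSum_succ]
    have h1 := ih (2 * x) (2 * y)
    have h2 := Real.abs_cos_sub_cos_le (2 * Real.pi * x - α) (2 * Real.pi * y - α)
    rw [← mul_sub, abs_mul, abs_two] at h1
    rw [sub_sub_sub_cancel_right, ← mul_sub, abs_mul, abs_of_pos Real.two_pi_pos] at h2
    rw [add_sub_add_comm]
    refine (abs_add_le _ _).trans ((add_le_add h1 h2).trans (le_of_eq ?_))
    ring

/-- An exponential moment bound for the doubling map over a translate of the dyadic grid. -/
theorem sum_exp_doublingCosSum_le (t α : ℝ) (N : ℕ) (x : ℝ) :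
    ∑ j ∈ Finset.range (2 ^ N), Real.exp (t * doublingCosSum α N (x + j / 2 ^ N))
      ≤ (2 * Real.exp (t ^ 2 / 2)) ^ N := by
  induction N generalizing x with
  | zero => simp [doublingCosSum]
  | succ N ih =>
    rw [show 2 ^ (N + 1) = 2 ^ N + 2 ^ N by ring, Finset.sum_range_add, ← Finset.sum_add_distrib,
      pow_succ (2 * Real.exp (t ^ 2 / 2))]
    refine le_trans ?_ (mul_le_mul_of_nonneg_right (ih (2 * x)) (by positivity))
    rw [Finset.sum_mul]
    refine Finset.sum_le_sum fun j _ => ?_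
    have e1 : 2 * (x + (j : ℝ) / 2 ^ (N + 1)) = 2 * x + j / 2 ^ N := by
      rw [pow_succ]; field_simp
    have e2 : 2 * (x + ((2 ^ N + j : ℕ) : ℝ) / 2 ^ (N + 1)) = 2 * x + j / 2 ^ N + (1 : ℤ) := by
      push_cast; field_simp; ring
    have e3 : 2 * Real.pi * (x + ((2 ^ N + j : ℕ) : ℝ) / 2 ^ (N + 1)) - α
        = 2 * Real.pi * (x + (j : ℝ) / 2 ^ (N + 1)) - α + Real.pi := by
      push_cast; field_simp; ring
    rw [doublingCosSum_succ, doublingCosSum_succ, e1, e2, doublingCosSum_add_intCast, e3,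
      Real.cos_add_pi]
    set S := doublingCosSum α N (2 * x + j / 2 ^ N)
    set C := Real.cos (2 * Real.pi * (x + (j : ℝ) / 2 ^ (N + 1)) - α) with hC
    have hcosh : Real.cosh (t * C) ≤ Real.exp (t ^ 2 / 2) := by
      refine (Real.cosh_le_exp_half_sq _).trans (Real.exp_le_exp.2 ?_)
      have hC1 : C ^ 2 ≤ 1 := Real.cos_sq_le_one _
      nlinarith [sq_nonneg t]
    have : Real.exp (t * (S + C)) + Real.exp (t * (S + -C))
        = Real.exp (t * S) * (2 * Real.cosh (t * C)) := by
      rw [Real.cosh_eq, mul_add, mul_add, Real.exp_add, Real.exp_add, mul_neg]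
      ring
    rw [this]
    gcongr

/-- The indices of the dyadic intervals of generation `N` in `[0, 1)` whose left endpoint has a
large cosine sum along its doubling orbit. -/
noncomputable def deviatingIndices (c α : ℝ) (N : ℕ) : Finset ℕ :=
  {j ∈ Finset.range (2 ^ N) | c * N - 2 * Real.pi ≤ doublingCosSum α N (j / 2 ^ N)}

theorem card_deviatingIndices_le {c : ℝ} (hc : 0 ≤ c) (α : ℝ) (N : ℕ) :
    ((deviatingIndices c α N).card : ℝ)
      ≤ Real.exp (2 * Real.pi * c) * (2 * Real.exp (-(c ^ 2 / 2))) ^ N := by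
  have h1 : ((deviatingIndices c α N).card : ℝ) * Real.exp (c * (c * N - 2 * Real.pi))
      ≤ (2 * Real.exp (c ^ 2 / 2)) ^ N := by
    rw [← nsmul_eq_mul]
    refine (Finset.card_nsmul_le_sum _
      (fun j : ℕ => Real.exp (c * doublingCosSum α N (j / 2 ^ N))) _ ?_).trans ?_
    · intro j hj
      have := (Finset.mem_filter.1 hj).2
      exact Real.exp_le_exp.2 (mul_le_mul_of_nonneg_left this hc)
    · refine (Finset.sum_le_sum_of_subset_of_nonneg (Finset.filter_subset _ _)
        fun _ _ _ => (Real.exp_pos _).le).trans ?_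
      simpa using sum_exp_doublingCosSum_le c α N 0
  rw [← le_div_iff₀ (Real.exp_pos _)] at h1
  refine h1.trans (le_of_eq ?_)
  rw [div_eq_iff (Real.exp_pos _).ne', mul_pow, mul_pow, ← Real.exp_nat_mul, ← Real.exp_nat_mul]
  have : Real.exp (N * (c ^ 2 / 2)) = Real.exp (2 * Real.pi * c) * Real.exp (N * -(c ^ 2 / 2))
      * Real.exp (c * (c * N - 2 * Real.pi)) := by
    rw [← Real.exp_add, ← Real.exp_add]
    congr 1
    ring
  rw [this]
  ring

theorem exists_mem_deviatingIndices {c α y : ℝ} {N : ℕ} (hy : y ∈ Set.Ico (0 : ℝ) 1)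
    (h : c * N ≤ doublingCosSum α N y) :
    ∃ j ∈ deviatingIndices c α N, y ∈ Set.Icc ((j : ℝ) / 2 ^ N) ((j + 1) / 2 ^ N) := by
  have h2 : (0 : ℝ) < 2 ^ N := by positivity
  have hy0 : 0 ≤ y * 2 ^ N := mul_nonneg hy.1 h2.le
  have hl := Nat.floor_le hy0
  have hr := Nat.lt_floor_add_one (y * 2 ^ N)
  have hmem : y ∈ Set.Icc ((⌊y * 2 ^ N⌋₊ : ℝ) / 2 ^ N) ((⌊y * 2 ^ N⌋₊ + 1) / 2 ^ N) :=
    ⟨(div_le_iff₀ h2).2 hl, (le_div_iff₀ h2).2 hr.le⟩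
  refine ⟨⌊y * 2 ^ N⌋₊, Finset.mem_filter.2 ⟨Finset.mem_range.2 ?_, ?_⟩, hmem⟩
  · rw [Nat.floor_lt hy0]
    push_cast
    nlinarith [hy.2]
  · have h3 := (abs_le.1 (abs_doublingCosSum_sub_le α N y (⌊y * 2 ^ N⌋₊ / 2 ^ N))).2
    have h5 : (2 ^ N - 1) * |y - (⌊y * 2 ^ N⌋₊ : ℝ) / 2 ^ N| ≤
        2 ^ N * |y - (⌊y * 2 ^ N⌋₊ : ℝ) / 2 ^ N| :=
      mul_le_mul_of_nonneg_right (by linarith) (abs_nonneg _)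
    have h4 : 2 ^ N * |y - (⌊y * 2 ^ N⌋₊ : ℝ) / 2 ^ N| ≤ 1 := by
      rw [abs_of_nonneg (sub_nonneg.2 hmem.1)]
      rw [mul_sub, mul_div_cancel₀ _ h2.ne']
      linarith
    nlinarith [Real.pi_pos]

theorem dimH_frequently_deviating_Ico_le {c : ℝ} (hc : 0 < c) (hc1 : c ≤ 1) (α : ℝ) :
    dimH {y : ℝ | y ∈ Set.Ico (0 : ℝ) 1 ∧ ∃ᶠ N : ℕ in atTop, c * N ≤ doublingCosSum α N y}
      ≤ ((Real.toNNReal (1 - c ^ 2 / 2) : ℝ≥0) : ℝ≥0∞) := by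
  set s : ℝ := 1 - c ^ 2 / 2 with hs
  have hs0 : 0 ≤ s := by nlinarith
  set K : ℝ := Real.exp (2 * Real.pi * c) with hK
  set ρ : ℝ := 2 * Real.exp (-(c ^ 2 / 2)) * (1 / 2 : ℝ) ^ s with hρ
  have hρ0 : 0 ≤ ρ := by positivity
  have hρ1 : ρ < 1 := by
    have h2 : (1 / 2 : ℝ) ^ s = Real.exp (-(Real.log 2 * s)) := by
      rw [Real.rpow_def_of_pos (by norm_num), one_div, Real.log_inv, neg_mul]
    have h3 : (2 : ℝ) = Real.exp (Real.log 2) := (Real.exp_log two_pos).symm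
    rw [hρ, h2]
    nth_rw 1 [h3]
    rw [← Real.exp_add, ← Real.exp_add, Real.exp_lt_one_iff]
    have h4 : Real.log 2 < 1 := by linarith [Real.log_two_lt_d9]
    rw [hs]
    nlinarith [pow_pos hc 2]
  refine dimH_le_of_hausdorffMeasure_ne_top (ne_top_of_le_ne_top ?_
    (Measure.hausdorffMeasure_le_liminf_tsum
      (ι := fun M : ℕ => Σ N : ℕ, {j // j ∈ deviatingIndices c α (N + M)}) (l := atTop)
      ((Real.toNNReal s : ℝ≥0) : ℝ) _ (fun M : ℕ => (2⁻¹ : ℝ≥0∞) ^ M)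
      (ENNReal.tendsto_pow_atTop_nhds_zero_of_lt_one (by norm_num))
      (fun M i => Set.Icc ((i.2.1 : ℝ) / 2 ^ (i.1 + M)) ((i.2.1 + 1) / 2 ^ (i.1 + M))) ?_ ?_))
  · rw [Real.coe_toNNReal _ hs0]
    have hbound : ∀ M : ℕ, ∑' i : (Σ N : ℕ, {j // j ∈ deviatingIndices c α (N + M)}),
        Metric.ediam (Set.Icc ((i.2.1 : ℝ) / 2 ^ (i.1 + M)) ((i.2.1 + 1) / 2 ^ (i.1 + M))) ^ s
        ≤ ∑' N : ℕ, ENNReal.ofReal (K * ρ ^ N) := by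
      intro M
      rw [ENNReal.tsum_sigma']
      refine ENNReal.tsum_le_tsum fun N => ?_
      have hd : ∀ j : ℕ, Metric.ediam
          (Set.Icc ((j : ℝ) / 2 ^ (N + M)) ((j + 1) / 2 ^ (N + M))) ^ s
          = ENNReal.ofReal (((1 / 2 : ℝ) ^ s) ^ (N + M)) := by
        intro j
        rw [Real.ediam_Icc, ENNReal.ofReal_rpow_of_nonneg _ hs0]
        · congr 1
          rw [← Real.rpow_natCast ((1 / 2 : ℝ) ^ s), ← Real.rpow_mul (by norm_num), mul_comm s,
            Real.rpow_mul (by norm_num), Real.rpow_natCast]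
          congr 1
          rw [one_div_pow]
          ring
        · rw [← sub_div]
          simp
      simp only [hd]
      rw [tsum_fintype, Finset.sum_const, Finset.card_univ, Fintype.card_coe, nsmul_eq_mul,
        ← ENNReal.ofReal_natCast, ← ENNReal.ofReal_mul (by positivity)]
      refine ENNReal.ofReal_le_ofReal ?_
      calc _ ≤ K * (2 * Real.exp (-(c ^ 2 / 2))) ^ (N + M) * ((1 / 2 : ℝ) ^ s) ^ (N + M) :=
            mul_le_mul_of_nonneg_right (card_deviatingIndices_le hc.le α _) (by positivity)
        _ = K * ρ ^ (N + M) := by rw [hρ, mul_pow _ ((1 / 2 : ℝ) ^ s)]; ring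
        _ ≤ K * ρ ^ N := mul_le_mul_of_nonneg_left
            (pow_le_pow_of_le_one hρ0 hρ1.le (Nat.le_add_right _ _)) (Real.exp_pos _).le
    refine ne_top_of_le_ne_top ?_ (liminf_le_of_le (a := ∑' N : ℕ, ENNReal.ofReal (K * ρ ^ N))
      (by isBoundedDefault) ?_)
    · exact ((summable_geometric_of_lt_one hρ0 hρ1).mul_left K).tsum_ofReal_ne_top
    · intro b hb
      obtain ⟨M, hM⟩ := hb.exists
      exact hM.trans (hbound M)
  · refine Eventually.of_forall fun M i => ?_
    rw [Real.ediam_Icc, ← sub_div, add_sub_cancel_left, one_div, ← inv_pow,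
      ENNReal.ofReal_pow (by norm_num), ENNReal.ofReal_inv_of_pos two_pos, ENNReal.ofReal_ofNat]
    exact pow_le_pow_of_le_one (by simp) (by simp) (Nat.le_add_left _ _)
  · refine Eventually.of_forall fun M y hy => ?_
    obtain ⟨N, hN, hyN⟩ := (frequently_atTop.1 hy.2) M
    obtain ⟨L, rfl⟩ := Nat.exists_eq_add_of_le' hN
    obtain ⟨j, hj, hyj⟩ := exists_mem_deviatingIndices hy.1 hyN
    exact Set.mem_iUnion.2 ⟨⟨L, j, hj⟩, hyj⟩

theorem dimH_frequently_deviating_le {c : ℝ} (hc : 0 < c) (hc1 : c ≤ 1) (α : ℝ) :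
    dimH {y : ℝ | ∃ᶠ N : ℕ in atTop, c * N ≤ doublingCosSum α N y}
      ≤ ((Real.toNNReal (1 - c ^ 2 / 2) : ℝ≥0) : ℝ≥0∞) := by
  have hsub : {y : ℝ | ∃ᶠ N : ℕ in atTop, c * N ≤ doublingCosSum α N y} ⊆
      ⋃ k : ℤ, IsometryEquiv.addRight (k : ℝ) '' {y : ℝ | y ∈ Set.Ico (0 : ℝ) 1 ∧
        ∃ᶠ N : ℕ in atTop, c * N ≤ doublingCosSum α N y} := by
    intro y hy
    refine Set.mem_iUnion.2 ⟨⌊y⌋, Int.fract y, ⟨⟨Int.fract_nonneg y, Int.fract_lt_one y⟩, ?_⟩,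
      Int.fract_add_floor y⟩
    refine hy.mono fun N hN => ?_
    rwa [← Int.fract_add_floor y, doublingCosSum_add_intCast] at hN
  refine (dimH_mono hsub).trans ?_
  rw [dimH_iUnion]
  refine iSup_le fun k => ?_
  rw [IsometryEquiv.dimH_image]
  exact dimH_frequently_deviating_Ico_le hc hc1 α
section Refinement

variable {φ m : ℝ → ℂ}

theorem refinement_two_pow_mul (h : ∀ ξ, φ (2 * ξ) = m ξ * φ ξ) (k : ℕ) (ξ : ℝ) :
    φ (2 ^ k * ξ) = (∏ j ∈ Finset.range k, m (2 ^ j * ξ)) * φ ξ := by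
  induction k with
  | zero => simp
  | succ k ih => rw [pow_succ', mul_assoc, h, ih, Finset.prod_range_succ]; ring

theorem refinement_two_pow_mul_intCast (h : ∀ ξ, φ (2 * ξ) = m ξ * φ ξ)
    (hm : ∀ (n : ℤ) ξ, m (n + ξ) = m ξ) (h0 : φ 0 = 1) (k : ℕ) (n : ℤ) :
    φ (2 ^ k * n) = φ n := by
  have hm0 : m 0 = 1 := by simpa [h0] using (h 0).symm
  rw [refinement_two_pow_mul h, Finset.prod_eq_one, one_mul]
  intro j _
  rw [← hm0, ← hm (2 ^ j * n) 0]
  simp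

theorem tendsto_inv_two_pow : Tendsto (fun k : ℕ => ((2 : ℝ) ^ k)⁻¹) atTop (𝓝 0) := by
  simp_rw [← inv_pow]
  exact tendsto_pow_atTop_nhds_zero_of_lt_one (by norm_num) (by norm_num)

theorem refinement_one_ne_zero (h : ∀ ξ, φ (2 * ξ) = m ξ * φ ξ) (h0 : φ 0 = 1)
    (hc : Continuous φ) (hm : ∀ j k : ℕ, m (2 ^ j / 2 ^ k) ≠ 0) : φ 1 ≠ 0 := by
  have ht : Tendsto (fun k : ℕ => φ ((2 : ℝ) ^ k)⁻¹) atTop (𝓝 1) := by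
    simpa [h0, Function.comp_def] using (hc.tendsto 0).comp tendsto_inv_two_pow
  obtain ⟨k, hk⟩ := (ht.eventually_ne one_ne_zero).exists
  have := refinement_two_pow_mul h k ((2 : ℝ) ^ k)⁻¹
  rw [mul_inv_cancel₀ (by positivity)] at this
  rw [this]
  exact mul_ne_zero (Finset.prod_ne_zero_iff.2 fun j _ => hm j k) hk

theorem tendsto_refinement_two_pow_sub_one (h : ∀ ξ, φ (2 * ξ) = m ξ * φ ξ)
    (hm : ∀ (n : ℤ) ξ, m (n + ξ) = m ξ) (h0 : φ 0 = 1) (hc : Continuous φ) :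
    Tendsto (fun k : ℕ => φ (2 ^ k - 1)) atTop (𝓝 (φ 1 * φ (-1))) := by
  have ht : Tendsto (fun k : ℕ => φ (-((2 : ℝ) ^ k)⁻¹)) atTop (𝓝 1) := by
    simpa [h0, Function.comp_def] using (hc.tendsto (-0)).comp tendsto_inv_two_pow.neg
  have ht1 : Tendsto (fun k : ℕ => φ (1 + -((2 : ℝ) ^ k)⁻¹)) atTop (𝓝 (φ 1)) := by
    simpa [Function.comp_def] using (hc.tendsto (1 + -0)).comp (tendsto_inv_two_pow.neg.const_add 1)
  have hlim := (ht1.mul_const (φ (-1))).div ht one_ne_zero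
  rw [div_one] at hlim
  refine hlim.congr' ?_
  filter_upwards [ht.eventually_ne one_ne_zero] with k hk
  have h2 : (2 : ℝ) ^ k ≠ 0 := by positivity
  have e1 := refinement_two_pow_mul h k (1 + -((2 : ℝ) ^ k)⁻¹)
  have e2 := refinement_two_pow_mul h k (-((2 : ℝ) ^ k)⁻¹)
  rw [show (2 : ℝ) ^ k * (1 + -((2 : ℝ) ^ k)⁻¹) = 2 ^ k - 1 by field_simp; ring] at e1
  rw [show (2 : ℝ) ^ k * -((2 : ℝ) ^ k)⁻¹ = -1 by field_simp] at e2
  have e3 : ∀ j : ℕ, m (2 ^ j * (1 + -((2 : ℝ) ^ k)⁻¹)) = m (2 ^ j * -((2 : ℝ) ^ k)⁻¹) := by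
    intro j
    rw [← hm (2 ^ j) (2 ^ j * -((2 : ℝ) ^ k)⁻¹), mul_add]
    simp
  simp only [e3] at e1
  rw [Pi.div_apply, div_eq_iff hk, e1, e2]
  ring

end Refinement

theorem sum_sum_dist_le {a : ℕ → ℝ} (ha : ∀ k, 0 ≤ a k) (N : ℕ) :
    ∑ i ∈ Finset.range N, ∑ j ∈ Finset.range N, a (Nat.dist i j)
      ≤ N * (2 * ∑ k ∈ Finset.range N, a k) := by
  rw [← nsmul_eq_mul]
  nth_rw 3 [← Finset.card_range N]
  refine Finset.sum_le_card_nsmul _ _ _ fun i hi => ?_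
  have hi' := Finset.mem_range.1 hi
  have key : ∀ s ⊆ Finset.range N, Set.InjOn (Nat.dist i) s →
      ∑ j ∈ s, a (Nat.dist i j) ≤ ∑ k ∈ Finset.range N, a k := by
    intro s hs hinj
    rw [← Finset.sum_image hinj]
    refine Finset.sum_le_sum_of_subset_of_nonneg ?_ fun k _ _ => ha k
    intro k hk
    obtain ⟨j, hj, rfl⟩ := Finset.mem_image.1 hk
    have := Finset.mem_range.1 (hs hj)
    simp only [Finset.mem_range, Nat.dist]
    omega
  rw [← Finset.sum_filter_add_sum_filter_not _ (fun j => j < i), two_mul]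
  refine add_le_add (key _ (Finset.filter_subset _ _) ?_) (key _ (Finset.filter_subset _ _) ?_) <;>
  · intro x hx y hy hxy
    simp only [Finset.coe_filter, Set.mem_ofPred_eq, Nat.dist] at hx hy hxy
    omega

/-- The character `y ↦ exp (2π i ξ y)`. -/
noncomputable def expChar (ξ y : ℝ) : ℂ := Complex.exp ((2 * Real.pi * ξ : ℝ) * y * Complex.I)

theorem norm_expChar (ξ y : ℝ) : ‖expChar ξ y‖ = 1 := by
  rw [expChar, ← Complex.ofReal_mul, Complex.norm_exp_ofReal_mul_I]

theorem continuous_expChar (ξ : ℝ) : Continuous (expChar ξ) := by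
  unfold expChar
  fun_prop

theorem expChar_mul_conj (ξ η y : ℝ) : expChar ξ y * conj (expChar η y) = expChar (ξ - η) y := by
  unfold expChar
  rw [← Complex.exp_conj, ← Complex.exp_add]
  congr 1
  simp [Complex.conj_ofNat]
  ring

theorem integral_expChar (ν : Measure ℝ) (ξ : ℝ) :
    ∫ y, expChar ξ y ∂ν = charFun ν (2 * Real.pi * ξ) := by
  rw [charFun_apply_real]
  rfl

section Decorrelation

variable {ν : Measure ℝ} [IsProbabilityMeasure ν]

theorem integrable_expChar (ξ : ℝ) : Integrable (expChar ξ) ν :=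
  Integrable.of_bound (continuous_expChar ξ).aestronglyMeasurable 1
    (ae_of_all _ fun y => (norm_expChar ξ y).le)

theorem integral_expChar_sub_mul_conj (ξ η : ℝ) (z : ℂ)
    (hξ : charFun ν (2 * Real.pi * ξ) = z) (hη : charFun ν (2 * Real.pi * η) = z) :
    ∫ y, (expChar ξ y - z) * conj (expChar η y - z) ∂ν
      = charFun ν (2 * Real.pi * (ξ - η)) - z * conj z := by
  have hi := fun ζ : ℝ => integrable_expChar (ν := ν) ζ
  have hconj : Integrable (fun y => conj (expChar η y)) ν := by
    simpa using! (Complex.conjCLE : ℂ →L[ℝ] ℂ).integrable_comp (hi η)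
  have e : ∀ y, (expChar ξ y - z) * conj (expChar η y - z)
      = (expChar (ξ - η) y - conj z * expChar ξ y) - (z * conj (expChar η y) - z * conj z) := by
    intro y
    rw [← expChar_mul_conj, map_sub]
    ring
  simp_rw [e]
  rw [integral_sub, integral_sub, integral_sub, integral_const_mul, integral_const_mul,
    integral_conj, integral_expChar, integral_expChar, integral_expChar, hξ, hη]
  · simp
    ring
  · exact hconj.const_mul z
  · exact integrable_const _
  · exact hi _
  · exact (hi ξ).const_mul _
  · exact (hi _).sub ((hi ξ).const_mul _)
  · exact (hconj.const_mul z).sub (integrable_const _)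

theorem integral_norm_sum_expChar_sub_sq_le (z : ℂ) {a : ℕ → ℝ} (ha : ∀ k, 0 ≤ a k)
    (hz : ∀ i : ℕ, charFun ν (2 * Real.pi * 2 ^ i) = z)
    (hcov : ∀ i j : ℕ, ‖charFun ν (2 * Real.pi * (2 ^ i - 2 ^ j)) - z * conj z‖ ≤ a (Nat.dist i j))
    (N : ℕ) :
    ∫ y, ‖∑ i ∈ Finset.range N, (expChar (2 ^ i) y - z)‖ ^ 2 ∂ν
      ≤ N * (2 * ∑ k ∈ Finset.range N, a k) := by
  have hint : ∀ i j : ℕ, Integrable (fun y => (expChar (2 ^ i) y - z) *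
      conj (expChar (2 ^ j) y - z)) ν := by
    intro i j
    refine Integrable.of_bound (C := (1 + ‖z‖) * (1 + ‖z‖)) ?_ (ae_of_all _ fun y => ?_)
    · have := continuous_expChar (2 ^ i)
      have := continuous_expChar (2 ^ j)
      refine Continuous.aestronglyMeasurable ?_
      exact Continuous.mul (by fun_prop) (Complex.continuous_conj.comp (by fun_prop))
    · rw [norm_mul, RCLike.norm_conj]
      have := fun k : ℕ => (norm_sub_le (expChar (2 ^ k) y) z).trans_eq (by rw [norm_expChar])
      exact mul_le_mul (this i) (this j) (norm_nonneg _) (by positivity)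
  have e : ((∫ y, ‖∑ i ∈ Finset.range N, (expChar (2 ^ i) y - z)‖ ^ 2 ∂ν : ℝ) : ℂ)
      = ∑ i ∈ Finset.range N, ∑ j ∈ Finset.range N,
        (charFun ν (2 * Real.pi * (2 ^ i - 2 ^ j)) - z * conj z) := by
    rw [← integral_complex_ofReal]
    have : ∀ y, ((‖∑ i ∈ Finset.range N, (expChar (2 ^ i) y - z)‖ ^ 2 : ℝ) : ℂ)
        = ∑ i ∈ Finset.range N, ∑ j ∈ Finset.range N,
          (expChar (2 ^ i) y - z) * conj (expChar (2 ^ j) y - z) := by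
      intro y
      rw [← Finset.sum_mul_sum, ← map_sum, Complex.mul_conj']
      simp
    simp_rw [this]
    rw [integral_finsetSum _ fun i _ => integrable_finsetSum _ fun j _ => hint i j]
    refine Finset.sum_congr rfl fun i _ => ?_
    rw [integral_finsetSum _ fun j _ => hint i j]
    refine Finset.sum_congr rfl fun j _ => ?_
    exact integral_expChar_sub_mul_conj _ _ z (hz i) (hz j)
  refine le_trans ?_ (sum_sum_dist_le ha N)
  refine (le_abs_self _).trans ?_
  rw [← Real.norm_eq_abs, ← Complex.norm_real, e]
  refine (norm_sum_le _ _).trans (Finset.sum_le_sum fun i _ => ?_)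
  exact (norm_sum_le _ _).trans (Finset.sum_le_sum fun j _ => hcov i j)

end Decorrelation

section FullMeasure

variable {ν : Measure ℝ} [IsProbabilityMeasure ν]

theorem mul_le_doublingCosSum_add_norm (z : ℂ) (N : ℕ) (y : ℝ) :
    ‖z‖ * N ≤ doublingCosSum z.arg N y + ‖∑ i ∈ Finset.range N, (expChar (2 ^ i) y - z)‖ := by
  have e : doublingCosSum z.arg N y - ‖z‖ * N
      = ((∑ i ∈ Finset.range N, (expChar (2 ^ i) y - z)) *
          Complex.exp ((-z.arg : ℝ) * Complex.I)).re := by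
    have hz : z * Complex.exp ((-z.arg : ℝ) * Complex.I) = ‖z‖ := by
      nth_rw 1 [← Complex.norm_mul_exp_arg_mul_I z]
      rw [mul_assoc, ← Complex.exp_add]
      simp
    rw [Finset.sum_mul, Complex.re_sum]
    simp_rw [sub_mul, hz, Complex.sub_re, Complex.ofReal_re]
    rw [Finset.sum_sub_distrib, Finset.sum_const, Finset.card_range, nsmul_eq_mul, mul_comm]
    congr 1
    refine Finset.sum_congr rfl fun i _ => ?_
    rw [expChar, ← Complex.exp_add, ← Complex.exp_ofReal_mul_I_re]
    congr 2
    push_cast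
    ring
  have h := (Complex.abs_re_le_norm ((∑ i ∈ Finset.range N, (expChar (2 ^ i) y - z)) *
          Complex.exp ((-z.arg : ℝ) * Complex.I)))
  rw [← e, norm_mul, Complex.norm_exp_ofReal_mul_I, mul_one] at h
  linarith [(abs_le.1 h).1]

theorem ae_frequently_mul_le_doublingCosSum {z : ℂ} (hz0 : z ≠ 0) {a : ℕ → ℝ} (ha : ∀ k, 0 ≤ a k)
    (ha0 : Tendsto a atTop (𝓝 0)) (hz : ∀ i : ℕ, charFun ν (2 * Real.pi * 2 ^ i) = z)
    (hcov : ∀ i j : ℕ,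
      ‖charFun ν (2 * Real.pi * (2 ^ i - 2 ^ j)) - z * conj z‖ ≤ a (Nat.dist i j)) :
    ∀ᵐ y ∂ν, ∃ᶠ N : ℕ in atTop, ‖z‖ / 2 * N ≤ doublingCosSum z.arg N y := by
  have hr : 0 < ‖z‖ := norm_pos_iff.2 hz0
  have hbad : ∀ N : ℕ, 0 < N → ν.real {y | doublingCosSum z.arg N y < ‖z‖ / 2 * N}
      ≤ 8 / ‖z‖ ^ 2 * ((N : ℝ)⁻¹ * ∑ k ∈ Finset.range N, a k) := by
    intro N hN
    have hN' : (0 : ℝ) < N := Nat.cast_pos.2 hN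
    have hcont : Continuous fun y => ‖∑ i ∈ Finset.range N, (expChar (2 ^ i) y - z)‖ ^ 2 := by
      have := fun i : ℕ => continuous_expChar (2 ^ i)
      fun_prop
    have hint : Integrable (fun y => ‖∑ i ∈ Finset.range N, (expChar (2 ^ i) y - z)‖ ^ 2) ν := by
      refine Integrable.of_bound (C := (∑ i ∈ Finset.range N, (1 + ‖z‖)) ^ 2)
        hcont.aestronglyMeasurable (ae_of_all _ fun y => ?_)
      rw [norm_pow, norm_norm]
      refine pow_le_pow_left₀ (norm_nonneg _) ((norm_sum_le _ _).trans
        (Finset.sum_le_sum fun i _ => ?_)) 2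
      exact (norm_sub_le _ _).trans_eq (by rw [norm_expChar])
    have hmarkov := mul_meas_ge_le_integral_of_nonneg
      (ae_of_all ν fun y => sq_nonneg ‖∑ i ∈ Finset.range N, (expChar (2 ^ i) y - z)‖) hint
      ((‖z‖ / 2 * N) ^ 2)
    have hsub : ν.real {y | doublingCosSum z.arg N y < ‖z‖ / 2 * N} ≤
        ν.real {y | (‖z‖ / 2 * N) ^ 2 ≤ ‖∑ i ∈ Finset.range N, (expChar (2 ^ i) y - z)‖ ^ 2} := by
      refine measureReal_mono fun y hy => ?_
      have h1 := mul_le_doublingCosSum_add_norm z N y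
      have h2 : doublingCosSum z.arg N y < ‖z‖ / 2 * N := hy
      have h3 : ‖z‖ / 2 * N ≤ ‖∑ i ∈ Finset.range N, (expChar (2 ^ i) y - z)‖ := by linarith
      exact pow_le_pow_left₀ (by positivity) h3 2
    have h3 := (mul_le_mul_of_nonneg_left hsub (sq_nonneg (‖z‖ / 2 * N))).trans
      (hmarkov.trans (integral_norm_sum_expChar_sub_sq_le z ha hz hcov N))
    rw [mul_comm, ← le_div_iff₀ (by positivity)] at h3
    refine h3.trans (le_of_eq ?_)
    field_simp
    ring
  have hlim : Tendsto (fun N : ℕ => 8 / ‖z‖ ^ 2 * ((N : ℝ)⁻¹ * ∑ k ∈ Finset.range N, a k))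
      atTop (𝓝 0) := by
    simpa using ha0.cesaro.const_mul (8 / ‖z‖ ^ 2)
  have hnull : ν (⋃ M : ℕ, {y | ∀ N ≥ M, doublingCosSum z.arg N y < ‖z‖ / 2 * N}) = 0 := by
    refine measure_iUnion_null fun M => ?_
    rw [← measureReal_eq_zero_iff]
    refine le_antisymm (ge_of_tendsto hlim ?_) measureReal_nonneg
    filter_upwards [eventually_ge_atTop M, eventually_gt_atTop 0] with N hM hN
    have hsub : {y | ∀ N ≥ M, doublingCosSum z.arg N y < ‖z‖ / 2 * N} ⊆
        {y | doublingCosSum z.arg N y < ‖z‖ / 2 * N} := fun y hy => hy N hM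
    exact (measureReal_mono hsub).trans (hbad N hN)
  rw [ae_iff]
  refine measure_mono_null (fun y hy => ?_) hnull
  obtain ⟨M, hM⟩ := eventually_atTop.1 (not_frequently.1 hy)
  exact Set.mem_iUnion.2 ⟨M, fun N hN => not_le.1 (hM N hN)⟩

/-- A probability measure on the line whose Fourier transform satisfies a dyadic refinement equation
with a `1`-periodic mask having no dyadic zeros is carried by a set of dimension less than one. -/
theorem exists_dimH_lt_one_of_refinement {m : ℝ → ℂ}
    (h : ∀ ξ, charFun ν (2 * Real.pi * (2 * ξ)) = m ξ * charFun ν (2 * Real.pi * ξ))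
    (hm : ∀ (n : ℤ) ξ, m (n + ξ) = m ξ) (hm0 : ∀ j k : ℕ, m (2 ^ j / 2 ^ k) ≠ 0) :
    ∃ s : ℝ≥0∞, s < 1 ∧ ∃ B : Set ℝ, MeasurableSet B ∧ ν B = 1 ∧ dimH B ≤ s := by
  set φ : ℝ → ℂ := fun ξ => charFun ν (2 * Real.pi * ξ) with hφ
  have hc : Continuous φ := continuous_charFun.comp (by fun_prop)
  have h0 : φ 0 = 1 := by simp [hφ]
  have hneg : ∀ ξ, φ (-ξ) = conj (φ ξ) := fun ξ => by
    simp only [hφ]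
    rw [mul_neg, charFun_neg]
  have hz0 : φ 1 ≠ 0 := refinement_one_ne_zero (φ := φ) h h0 hc hm0
  have hz : ∀ i : ℕ, φ (2 ^ i) = φ 1 := fun i => by
    simpa using refinement_two_pow_mul_intCast (φ := φ) h hm h0 i 1
  have hlim : Tendsto (fun k : ℕ => ‖φ (2 ^ k - 1) - φ 1 * conj (φ 1)‖) atTop (𝓝 0) := by
    have := (tendsto_refinement_two_pow_sub_one (φ := φ) h hm h0 hc).sub_const (φ 1 * φ (-1))
    rw [sub_self, hneg] at this
    simpa using this.norm
  have hcov' : ∀ j k : ℕ, φ (2 ^ (j + k) - 2 ^ j) = φ (2 ^ k - 1) := fun j k => by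
    have := refinement_two_pow_mul_intCast (φ := φ) h hm h0 j (2 ^ k - 1)
    push_cast at this
    rw [← this]
    congr 1
    ring
  have hcov : ∀ i j : ℕ, ‖φ (2 ^ i - 2 ^ j) - φ 1 * conj (φ 1)‖
      ≤ ‖φ (2 ^ Nat.dist i j - 1) - φ 1 * conj (φ 1)‖ := by
    intro i j
    rcases le_total j i with hij | hij
    · obtain ⟨k, rfl⟩ := Nat.exists_eq_add_of_le hij
      rw [hcov', Nat.dist_eq_sub_of_le_right hij, Nat.add_sub_cancel_left]
    · obtain ⟨k, rfl⟩ := Nat.exists_eq_add_of_le hij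
      rw [Nat.dist_eq_sub_of_le hij, Nat.add_sub_cancel_left, ← neg_sub ((2 : ℝ) ^ (i + k)), hneg, hcov',
        ← RCLike.norm_conj]
      simp [mul_comm]
  have hae := ae_frequently_mul_le_doublingCosSum hz0 (fun k => norm_nonneg _) hlim hz hcov
  have hr : 0 < ‖φ 1‖ := norm_pos_iff.2 hz0
  have hr1 : ‖φ 1‖ ≤ 1 := norm_charFun_le_one _
  have hB : MeasurableSet {y | ∃ᶠ N : ℕ in atTop, ‖φ 1‖ / 2 * N ≤ doublingCosSum (φ 1).arg N y} := by
    have := MeasurableSet.measurableSet_limsup fun N : ℕ =>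
      (isClosed_le continuous_const (continuous_doublingCosSum (φ 1).arg N) :
        IsClosed {y | ‖φ 1‖ / 2 * N ≤ doublingCosSum (φ 1).arg N y}).measurableSet
    convert this using 1
    ext y
    rw [mem_limsup_iff_frequently_mem]
    rfl
  refine ⟨_, ?_, _, hB, (prob_compl_eq_zero_iff hB).1 hae,
    dimH_frequently_deviating_le (half_pos hr) (by linarith) _⟩
  rw [ENNReal.coe_lt_one_iff, Real.toNNReal_lt_one]
  have := pow_pos (half_pos hr) 2
  linarith

end FullMeasure

theorem one_add_add_ne_zero_of_pow_two_pow {z w : ℂ} (hz : ‖z‖ = 1) (hw : ‖w‖ = 1) {k : ℕ}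
    (hzk : z ^ 2 ^ k = 1) : 1 + z + w ≠ 0 := by
  intro h
  have hz' : z * conj z = 1 := by rw [Complex.mul_conj', hz]; simp
  have hw' : w * conj w = 1 := by rw [Complex.mul_conj', hw]; simp
  have h' : 1 + conj z + conj w = 0 := by simpa using congrArg conj h
  have hzw : z * w = 1 := by
    linear_combination (z * w) * h' - w * hz' - z * hw' - h
  have hz3 : z ^ 3 = 1 := by
    linear_combination (z - 1) * (z * h - hzw)
  have hcop : Nat.Coprime 3 (2 ^ k) := Nat.Coprime.pow_right k (by norm_num)
  have hz1 : z = 1 := by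
    have := pow_gcd_eq_one.2 ⟨hz3, hzk⟩
    rwa [hcop, pow_one] at this
  have : w = -2 := by
    rw [hz1] at h
    linear_combination h
  rw [this] at hw
  norm_num at hw

/-- For coprime positive integers `p ≤ q` and `θ = arctan(p/q)`, the
dimension of `μ_θ` is strictly less than 1: there are `s < 1` and a Borel set
`A ⊆ ℝ` of full `μ_θ`-measure with Hausdorff dimension at most `s`. -/
theorem stmt_3 (p q : ℕ) (hp : 0 < p) (hq : 0 < q) (hpq : p ≤ q)
    (hcop : Nat.Coprime p q)
    (μ : Measure ℝ) (hprob : IsProbabilityMeasure μ)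
    (hself : ∀ A : Set ℝ, MeasurableSet A →
      μ A = (1 / 3) * (μ ((fun x => 2 * x) '' A) + μ ((fun x => 2 * x - 1) '' A)
        + μ ((fun x => 2 * x - (p : ℝ) / (q : ℝ)) '' A))) :
    ∃ s : ENNReal, s < 1 ∧ ∃ A : Set ℝ, MeasurableSet A ∧ μ A = 1 ∧ dimH A ≤ s := by
  have hq0 : (q : ℝ) ≠ 0 := Nat.cast_ne_zero.2 hq.ne'
  have hν : IsProbabilityMeasure (μ.map fun x => (q : ℝ) * x) :=
    Measure.isProbabilityMeasure_map (by fun_prop)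
  have hexp : ∀ (n : ℤ) (d : ℕ) (ξ : ℝ), expChar (n + ξ) d = expChar ξ d := by
    intro n d ξ
    rw [expChar, expChar, Complex.exp_eq_exp_iff_exists_int]
    refine ⟨n * d, ?_⟩
    push_cast
    ring
  have hrefine : ∀ ξ : ℝ, charFun (μ.map fun x => (q : ℝ) * x) (2 * Real.pi * (2 * ξ))
      = (1 + expChar ξ q + expChar ξ p) / 3 *
        charFun (μ.map fun x => (q : ℝ) * x) (2 * Real.pi * ξ) := by
    intro ξ
    have himg : ∀ (d : ℝ) (A : Set ℝ),
        (fun x => 2 * x - d) '' A = (fun x => (x + d) / 2) ⁻¹' A := fun d A =>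
      congrFun (Set.image_eq_preimage_of_inverse (fun x => by ring)
        (fun x => by ring)) A
    have hμ : μ = (1 / 3 : ℝ≥0∞) • (μ.map (fun x => (x + 0) / 2) + μ.map (fun x => (x + 1) / 2)
        + μ.map (fun x => (x + (p : ℝ) / q) / 2)) := by
      ext A hA
      have h0 := himg 0 A
      simp only [sub_zero] at h0
      rw [hself A hA, Measure.smul_apply, Measure.add_apply, Measure.add_apply,
        Measure.map_apply (by fun_prop) hA, Measure.map_apply (by fun_prop) hA,
        Measure.map_apply (by fun_prop) hA, himg, himg, h0, smul_eq_mul]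
    have hmap : ∀ d t : ℝ, charFun (μ.map fun x => (x + d) / 2) (2 * t)
        = Complex.exp (t * d * Complex.I) * charFun μ t := by
      intro d t
      rw [charFun_apply_real, charFun_apply_real, integral_map (by fun_prop)
        (by fun_prop), ← integral_const_mul]
      refine integral_congr_ae (ae_of_all _ fun x => ?_)
      simp only
      rw [← Complex.exp_add]
      congr 1
      push_cast
      ring
    have hchar : ∀ t : ℝ, charFun μ (2 * t) = (1 + Complex.exp (t * Complex.I) +
        Complex.exp (t * (p / q : ℝ) * Complex.I)) / 3 * charFun μ t := by
      intro t
      have h1 := congrArg (fun ρ : Measure ℝ => charFun ρ (2 * t)) hμ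
      have hi : ∀ ρ : Measure ℝ, IsProbabilityMeasure ρ →
          Integrable (fun x : ℝ => Complex.exp ((2 * t : ℝ) * x * Complex.I)) ρ := fun ρ _ => by
        refine Integrable.of_bound (C := 1) (by fun_prop) (ae_of_all _ fun x => ?_)
        rw [← Complex.ofReal_mul, Complex.norm_exp_ofReal_mul_I]
      have hpr : ∀ d : ℝ, IsProbabilityMeasure (μ.map fun x => (x + d) / 2) := fun d =>
        Measure.isProbabilityMeasure_map (by fun_prop)
      rw [h1, charFun_apply_real, integral_smul_measure, integral_add_measure,
        integral_add_measure, ← charFun_apply_real, ← charFun_apply_real, ← charFun_apply_real,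
        hmap, hmap, hmap]
      · simp
        ring
      · exact hi _ (hpr 0)
      · exact hi _ (hpr 1)
      · exact (hi _ (hpr 0)).add_measure (hi _ (hpr 1))
      · exact hi _ (hpr _)
    rw [charFun_map_mul, charFun_map_mul, show (q : ℝ) * (2 * Real.pi * (2 * ξ))
      = 2 * (q * (2 * Real.pi * ξ)) by ring, hchar]
    have hξq : Complex.exp ((q * (2 * Real.pi * ξ) : ℝ) * Complex.I) = expChar ξ q := by
      rw [expChar]
      congr 1
      push_cast
      ring
    have hξp : Complex.exp ((q * (2 * Real.pi * ξ) : ℝ) * (p / q : ℝ) * Complex.I)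
        = expChar ξ p := by
      have hqC : (q : ℂ) ≠ 0 := Nat.cast_ne_zero.2 hq.ne'
      rw [expChar]
      congr 1
      push_cast
      field_simp
    rw [hξq, hξp]
  have hmask : ∀ j k : ℕ,
      (1 + expChar (2 ^ j / 2 ^ k) q + expChar (2 ^ j / 2 ^ k) p) / 3 ≠ 0 := by
    intro j k
    have hpow : expChar (2 ^ j / 2 ^ k) q ^ 2 ^ k = 1 := by
      rw [expChar, ← Complex.exp_nat_mul, Complex.exp_eq_one_iff]
      refine ⟨2 ^ j * q, ?_⟩
      push_cast
      field_simp
    exact div_ne_zero (one_add_add_ne_zero_of_pow_two_pow (norm_expChar _ _) (norm_expChar _ _)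
      hpow) three_ne_zero
  obtain ⟨s, hs, B, hB, hνB, hdim⟩ := exists_dimH_lt_one_of_refinement hrefine
    (fun n ξ => by simp only [hexp]) hmask
  have hBA : MeasurableSet ((fun x => (q : ℝ) * x) ⁻¹' B) := (measurable_const_mul _) hB
  refine ⟨s, hs, (fun x => (q : ℝ) * x) ⁻¹' B, hBA, ?_, le_trans ?_ hdim⟩
  · rwa [Measure.map_apply (by fun_prop) hB] at hνB
  · have hanti : AntilipschitzWith (Real.toNNReal (q : ℝ)⁻¹) fun x : ℝ => (q : ℝ) * x := by
      refine AntilipschitzWith.of_le_mul_dist fun x y => ?_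
      rw [Real.coe_toNNReal _ (by positivity), Real.dist_eq, Real.dist_eq, ← mul_sub, abs_mul,
        Nat.abs_cast, inv_mul_cancel_left₀ hq0]
    exact hanti.dimH_preimage_le B
end

section
/- Let p ≤ q be coprime positive integers and D = {0, 1, p/q} ⊆ ℚ. For all n ∈ ℕ and all x, y ∈ D^n, the rational number q·R_n(x,y) is an integer. Moreover, if (x,y) is recoverable, i.e. |R_k(x,y)| < 1 for every 1 ≤ k ≤ n, then q·R_n(x,y) ∈ {−q+1, −q+2, …, −1, 0, 1, …, q−2, q−1}. -/
/-- The `k`-th scaled remainder (recoverability) function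
`R_k(x,y) = ∑_{i=1}^k 2^{k-i} (x_i - y_i)` (here `0`-indexed: position `i+1`
carries the factor `2^{k-1-i}`). -/
def Rrem (x y : ℕ → ℚ) (k : ℕ) : ℚ :=
  ∑ i ∈ Finset.range k, 2 ^ (k - 1 - i) * (x i - y i)

theorem exists_int_mul_digit {p q : ℕ} (hq : 0 < q) {d : ℚ}
    (hd : d ∈ ({0, 1, (p : ℚ) / (q : ℚ)} : Set ℚ)) : ∃ j : ℤ, (q : ℚ) * d = j := by
  have hq' : (q : ℚ) ≠ 0 := by positivity
  rcases hd with rfl | rfl | rfl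
  · exact ⟨0, by simp⟩
  · exact ⟨q, by simp⟩
  · exact ⟨p, by rw [mul_div_cancel₀ _ hq']; simp⟩

theorem exists_int_mul_Rrem {q n : ℕ} {x y : ℕ → ℚ}
    (hx : ∀ i < n, ∃ j : ℤ, (q : ℚ) * x i = j) (hy : ∀ i < n, ∃ j : ℤ, (q : ℚ) * y i = j) :
    ∃ j : ℤ, (q : ℚ) * Rrem x y n = j := by
  choose! a ha using hx
  choose! b hb using hy
  refine ⟨∑ i ∈ Finset.range n, 2 ^ (n - 1 - i) * (a i - b i), ?_⟩
  rw [Rrem, Finset.mul_sum]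
  push_cast
  refine Finset.sum_congr rfl fun i hi => ?_
  rw [← ha i (Finset.mem_range.1 hi), ← hb i (Finset.mem_range.1 hi)]
  ring

/-- For coprime positive integers `p ≤ q`, `D = {0, 1, p/q} ⊆ ℚ` and
words `x, y ∈ D^n`, the rational `q·R_n(x,y)` is an integer; moreover if `(x,y)` is
recoverable (`|R_k(x,y)| < 1` for all `1 ≤ k ≤ n`), then
`q·R_n(x,y) ∈ {-q+1, …, q-1}`. -/
theorem stmt_4 (p q : ℕ) (hp : 0 < p) (hq : 0 < q) (hpq : p ≤ q)
    (hcop : Nat.Coprime p q) (n : ℕ) (x y : ℕ → ℚ)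
    (hx : ∀ i < n, x i ∈ ({0, 1, (p : ℚ) / (q : ℚ)} : Set ℚ))
    (hy : ∀ i < n, y i ∈ ({0, 1, (p : ℚ) / (q : ℚ)} : Set ℚ)) :
    (∃ j : ℤ, (q : ℚ) * Rrem x y n = (j : ℚ)) ∧
      ((∀ k, 1 ≤ k → k ≤ n → |Rrem x y k| < 1) →
        ∃ j : ℤ, (q : ℚ) * Rrem x y n = (j : ℚ) ∧
          -(q : ℤ) + 1 ≤ j ∧ j ≤ (q : ℤ) - 1) := by
  obtain ⟨j, hj⟩ := exists_int_mul_Rrem (fun i hi => exists_int_mul_digit hq (hx i hi))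
    (fun i hi => exists_int_mul_digit hq (hy i hi))
  refine ⟨⟨j, hj⟩, fun h => ⟨j, hj, ?_⟩⟩
  have hR : |Rrem x y n| < 1 := by
    rcases Nat.eq_zero_or_pos n with rfl | hn
    · simp [Rrem]
    · exact h n hn le_rfl
  have hq' : (0 : ℚ) < q := by exact_mod_cast hq
  have hlt : |(j : ℚ)| < q := by
    rw [← hj, abs_mul, abs_of_pos hq']
    exact mul_lt_of_lt_one_right hq' hR
  have hlt' : |j| < (q : ℤ) := by exact_mod_cast hlt
  rw [abs_lt] at hlt'
  omega
end

section
/- Let p ≤ q be coprime positive integers and D = {0, 1, p/q} ⊆ ℚ. If x, y ∈ D^n form a recoverable pair, i.e. |R_k(x,y)| < 1 for every 1 ≤ k ≤ n, then there exist m ≥ n and extensions x', y' ∈ D^m with x'_i = x_i and y'_i = y_i for all i ≤ n such that ∑_{i=1}^m x'_i 2^{-i} = ∑_{i=1}^m y'_i 2^{-i} (the extended words exactly overlap). -/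
theorem Rrem_succ (x y : ℕ → ℚ) (k : ℕ) :
    Rrem x y (k + 1) = 2 * Rrem x y k + (x k - y k) := by
  unfold Rrem
  rw [Finset.sum_range_succ, Finset.mul_sum]
  congr 1
  · refine Finset.sum_congr rfl fun i hi => ?_
    have hi' := Finset.mem_range.mp hi
    rw [show k + 1 - 1 - i = (k - 1 - i) + 1 by omega, pow_succ]
    ring
  · simp

theorem Rrem_congr {x y x' y' : ℕ → ℚ} {k : ℕ} (hx : ∀ i < k, x' i = x i)
    (hy : ∀ i < k, y' i = y i) : Rrem x' y' k = Rrem x y k := by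
  refine Finset.sum_congr rfl fun i hi => ?_
  rw [hx i (Finset.mem_range.mp hi), hy i (Finset.mem_range.mp hi)]

theorem Rrem_eq_two_pow_mul (x y : ℕ → ℚ) (k : ℕ) :
    Rrem x y k = 2 ^ k * (∑ i ∈ Finset.range k, x i / 2 ^ (i + 1)
      - ∑ i ∈ Finset.range k, y i / 2 ^ (i + 1)) := by
  induction k with
  | zero => simp [Rrem]
  | succ k ih =>
    rw [Rrem_succ, ih, Finset.sum_range_succ, Finset.sum_range_succ]
    field_simp
    ring

/-- Every difference `ε₁ t + ε₂ (1 - t) - ε₃` with `εᵢ ∈ {0, 1}` is a difference of two digits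
in `{0, 1, t}`. -/
theorem exists_digits_sub_eq (t : ℚ) {u v w : ℕ} (hu : u < 2) (hv : v < 2) (hw : w < 2) :
    ∃ a ∈ ({0, 1, t} : Set ℚ), ∃ b ∈ ({0, 1, t} : Set ℚ),
      a - b = u * t + v * (1 - t) - w := by
  interval_cases u <;> interval_cases v <;> interval_cases w
  · exact ⟨0, by simp, 0, by simp, by simp⟩
  · exact ⟨0, by simp, 1, by simp, by simp⟩
  · exact ⟨1, by simp, t, by simp, by simp⟩
  · exact ⟨0, by simp, t, by simp, by simp⟩
  · exact ⟨t, by simp, 0, by simp, by simp⟩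
  · exact ⟨t, by simp, 1, by simp, by simp⟩
  · exact ⟨1, by simp, 0, by simp, by simp⟩
  · exact ⟨0, by simp, 0, by simp, by simp⟩

theorem exists_extension_Rrem_eq (t : ℚ) (n : ℕ) (x y : ℕ → ℚ)
    (hx : ∀ i < n, x i ∈ ({0, 1, t} : Set ℚ)) (hy : ∀ i < n, y i ∈ ({0, 1, t} : Set ℚ))
    (k : ℕ) : ∀ U V W : ℕ, U < 2 ^ k → V < 2 ^ k → W < 2 ^ k →
    ∃ x' y' : ℕ → ℚ,
      (∀ i < n + k, x' i ∈ ({0, 1, t} : Set ℚ)) ∧ (∀ i < n + k, y' i ∈ ({0, 1, t} : Set ℚ)) ∧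
      (∀ i < n, x' i = x i) ∧ (∀ i < n, y' i = y i) ∧
      Rrem x' y' (n + k) = 2 ^ k * Rrem x y n + (U * t + V * (1 - t) - W) := by
  induction k with
  | zero =>
    intro U V W hU hV hW
    obtain rfl : U = 0 := by simpa using hU
    obtain rfl : V = 0 := by simpa using hV
    obtain rfl : W = 0 := by simpa using hW
    exact ⟨x, y, hx, hy, fun _ _ => rfl, fun _ _ => rfl, by simp⟩
  | succ k ih =>
    intro U V W hU hV hW
    obtain ⟨x', y', hx', hy', hxx, hyy, hR⟩ :=
      ih (U / 2) (V / 2) (W / 2) (by omega) (by omega) (by omega)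
    obtain ⟨a, ha, b, hb, hab⟩ := exists_digits_sub_eq t (Nat.mod_lt U two_pos)
      (Nat.mod_lt V two_pos) (Nat.mod_lt W two_pos)
    have hne : ∀ i < n + k, i ≠ n + k := fun i hi => hi.ne
    refine ⟨Function.update x' (n + k) a, Function.update y' (n + k) b, ?_, ?_, ?_, ?_, ?_⟩
    · intro i hi
      rcases eq_or_ne i (n + k) with rfl | h
      · simpa using ha
      · rw [Function.update_of_ne h]
        exact hx' i (by omega)
    · intro i hi
      rcases eq_or_ne i (n + k) with rfl | h
      · simpa using hb
      · rw [Function.update_of_ne h]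
        exact hy' i (by omega)
    · intro i hi
      rw [Function.update_of_ne (by omega), hxx i hi]
    · intro i hi
      rw [Function.update_of_ne (by omega), hyy i hi]
    · rw [← add_assoc, Rrem_succ, Rrem_congr (x := x') (y := y')
        (fun i hi => Function.update_of_ne (hne i hi) _ _)
        (fun i hi => Function.update_of_ne (hne i hi) _ _), hR,
        Function.update_self, Function.update_self, hab]
      have cast_div_add_mod (N : ℕ) : (N : ℚ) = 2 * (N / 2 : ℕ) + (N % 2 : ℕ) := by
        exact_mod_cast (Nat.div_add_mod N 2).symm
      rw [cast_div_add_mod U, cast_div_add_mod V, cast_div_add_mod W]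
      ring

theorem exists_int_mul_Rrem_eq {p q : ℕ} (hq : 0 < q) {x y : ℕ → ℚ} {n : ℕ}
    (hx : ∀ i < n, x i ∈ ({0, 1, (p : ℚ) / (q : ℚ)} : Set ℚ))
    (hy : ∀ i < n, y i ∈ ({0, 1, (p : ℚ) / (q : ℚ)} : Set ℚ)) :
    ∃ s : ℤ, (q : ℚ) * Rrem x y n = s := by
  have hq' : (q : ℚ) ≠ 0 := by positivity
  have digit : ∀ a ∈ ({0, 1, (p : ℚ) / (q : ℚ)} : Set ℚ), ∃ c : ℤ, (q : ℚ) * a = c := by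
    rintro a (rfl | rfl | rfl)
    · exact ⟨0, by simp⟩
    · exact ⟨q, by simp⟩
    · exact ⟨p, by field_simp; simp⟩
  induction n with
  | zero => exact ⟨0, by simp [Rrem]⟩
  | succ n ih =>
    obtain ⟨s, hs⟩ := ih (fun i hi => hx i (by omega)) (fun i hi => hy i (by omega))
    obtain ⟨c, hc⟩ := digit _ (hx n n.lt_succ_self)
    obtain ⟨d, hd⟩ := digit _ (hy n n.lt_succ_self)
    refine ⟨2 * s + (c - d), ?_⟩
    rw [Rrem_succ]
    push_cast
    linear_combination 2 * hs + hc - hd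

theorem exists_nat_lt_sub_eq {a b : ℤ} {N : ℕ} (ha : |a| < N) (hb : |b| < N)
    (hab : |a - b| < N) :
    ∃ U V W : ℕ, U < N ∧ V < N ∧ W < N ∧ (U : ℤ) - W = a ∧ (V : ℤ) - W = b := by
  rw [abs_lt] at ha hb hab
  let W : ℤ := max 0 (max (-a) (-b))
  exact ⟨(a + W).toNat, (b + W).toNat, W.toNat, by omega, by omega, by omega, by omega, by omega⟩

/-- The combinations `p U + (q - p) V - q W` with `U, V, W < 2 ^ k` eventually cover
the dilate `2 ^ k s` of any `s` with `|s| < q`. -/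
theorem exists_two_pow_mul_add_eq_zero {p q : ℕ} (hpq : p ≤ q) (hcop : Nat.Coprime p q)
    {s : ℤ} (hs : |s| < q) :
    ∃ k U V W : ℕ, U < 2 ^ k ∧ V < 2 ^ k ∧ W < 2 ^ k ∧
      2 ^ k * s + (p * U + (q - p) * V - q * W : ℤ) = 0 := by
  have hq : (0 : ℤ) < q := (abs_nonneg s).trans_lt hs
  obtain ⟨k, hk⟩ : ∃ k : ℕ, q * (q + 1) < 2 ^ k := ⟨_, Nat.lt_two_pow_self⟩
  have hk' : (q : ℤ) * (q + 1) < 2 ^ k := by exact_mod_cast hk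
  have hp' : (p : ℤ) ≤ q := by exact_mod_cast hpq
  have hp0 : (0 : ℤ) ≤ p := by positivity
  obtain ⟨c, b, hc0, hcq, hcb⟩ :
      ∃ c b : ℤ, 0 ≤ c ∧ c < q ∧ q * b + p * c = -(2 ^ k * s) := by
    obtain ⟨u, v, huv⟩ := Nat.isCoprime_iff_coprime.mpr hcop
    set T : ℤ := -(2 ^ k * s)
    refine ⟨(T * u) % q, T * v + p * ((T * u) / q), Int.emod_nonneg _ hq.ne',
      Int.emod_lt_of_pos _ hq, ?_⟩
    linear_combination (p : ℤ) * Int.emod_add_mul_ediv (T * u) q + T * huv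
  obtain ⟨hs1, hs2⟩ := abs_lt.mp hs
  have hpc : (p : ℤ) * c ≤ q * q := by gcongr
  have hpc0 : 0 ≤ (p : ℤ) * c := by positivity
  have hqc : ((q : ℤ) - p) * c ≤ q * q := by
    apply mul_le_mul <;> linarith
  have hqc0 : 0 ≤ ((q : ℤ) - p) * c := mul_nonneg (by linarith) hc0
  have hP : (0 : ℤ) < 2 ^ k := by positivity
  have hlo : (2 : ℤ) ^ k * s ≤ 2 ^ k * (q - 1) := by gcongr; omega
  have hhi : (2 : ℤ) ^ k * (-(q - 1)) ≤ 2 ^ k * s := by gcongr; omega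
  obtain ⟨U, V, W, hU, hV, hW, ha, hb⟩ :=
    exists_nat_lt_sub_eq (a := b + c) (b := b) (N := 2 ^ k)
      (by
        push_cast
        rw [abs_lt]
        constructor <;> refine lt_of_mul_lt_mul_left ?_ hq.le <;> nlinarith)
      (by
        push_cast
        rw [abs_lt]
        constructor <;> refine lt_of_mul_lt_mul_left ?_ hq.le <;> nlinarith)
      (by
        push_cast
        rw [abs_lt]
        constructor <;> nlinarith)
  refine ⟨k, U, V, W, hU, hV, hW, ?_⟩
  linear_combination (p : ℤ) * ha + (q - p : ℤ) * hb + hcb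

/-- For coprime positive integers `p ≤ q` and `D = {0, 1, p/q} ⊆ ℚ`,
any recoverable pair of words `x, y ∈ D^n` admits extensions `x', y' ∈ D^m`
(`m ≥ n`, agreeing with `x, y` on the first `n` letters) which exactly overlap:
`∑_{i=1}^m x'_i 2^{-i} = ∑_{i=1}^m y'_i 2^{-i}`. -/
theorem stmt_6 (p q : ℕ) (hp : 0 < p) (hq : 0 < q) (hpq : p ≤ q)
    (hcop : Nat.Coprime p q) (n : ℕ) (x y : ℕ → ℚ)
    (hx : ∀ i < n, x i ∈ ({0, 1, (p : ℚ) / (q : ℚ)} : Set ℚ))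
    (hy : ∀ i < n, y i ∈ ({0, 1, (p : ℚ) / (q : ℚ)} : Set ℚ))
    (hrec : ∀ k, 1 ≤ k → k ≤ n → |Rrem x y k| < 1) :
    ∃ m, n ≤ m ∧ ∃ x' y' : ℕ → ℚ,
      (∀ i < m, x' i ∈ ({0, 1, (p : ℚ) / (q : ℚ)} : Set ℚ)) ∧
      (∀ i < m, y' i ∈ ({0, 1, (p : ℚ) / (q : ℚ)} : Set ℚ)) ∧
      (∀ i < n, x' i = x i) ∧ (∀ i < n, y' i = y i) ∧
      ∑ i ∈ Finset.range m, x' i / 2 ^ (i + 1)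
        = ∑ i ∈ Finset.range m, y' i / 2 ^ (i + 1) := by
  have hq' : (0 : ℚ) < q := by positivity
  obtain ⟨s, hs⟩ := exists_int_mul_Rrem_eq hq hx hy
  have hR : |Rrem x y n| < 1 := by
    rcases Nat.eq_zero_or_pos n with rfl | hn
    · simp [Rrem]
    · exact hrec n hn le_rfl
  have hsq : |s| < q := by
    have h : |(s : ℚ)| < q := by
      rw [← hs, abs_mul, abs_of_pos hq']
      exact mul_lt_of_lt_one_right hq' hR
    exact_mod_cast h
  obtain ⟨k, U, V, W, hU, hV, hW, hsum⟩ := exists_two_pow_mul_add_eq_zero hpq hcop hsq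
  obtain ⟨x', y', hx', hy', hxx, hyy, hR'⟩ :=
    exists_extension_Rrem_eq _ n x y hx hy k U V W hU hV hW
  refine ⟨n + k, Nat.le_add_right n k, x', y', hx', hy', hxx, hyy, ?_⟩
  have hsum' : (2 : ℚ) ^ k * s + (p * U + (q - p) * V - q * W) = 0 := by exact_mod_cast hsum
  have hzero : Rrem x' y' (n + k) = 0 := by
    refine (mul_eq_zero.mp ?_).resolve_left hq'.ne'
    rw [hR', ← hsum', ← hs]
    field_simp
  rw [Rrem_eq_two_pow_mul] at hzero
  exact sub_eq_zero.mp ((mul_eq_zero.mp hzero).resolve_left (by positivity))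
end

section
/- For every nonempty finite word z = z_1⋯z_n over the alphabet B, the matrix product A_z = A_{z_1}⋯A_{z_n} has at most one zero row: there is at most one index i ∈ {1,2,3,4} such that every entry of row i of A_z equals 0. -/
/-- The four matrices `A_b` indexed by `B = {(0,0),(1,0),(0,1),(1,1)}`
(encoded as `Bool × Bool`, `false ↦ 0`, `true ↦ 1`). -/
def Amat : Bool × Bool → Matrix (Fin 4) (Fin 4) ℕ
  | (false, false) => !![3,1,1,1; 0,1,0,0; 0,0,1,0; 0,0,0,1]
  | (true, false)  => !![1,0,1,0; 1,3,0,1; 0,0,0,0; 0,0,1,1]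
  | (false, true)  => !![1,1,0,0; 0,0,0,0; 1,0,3,1; 0,1,0,1]
  | (true, true)   => !![1,0,0,0; 0,1,0,0; 0,0,1,0; 1,1,1,3]

/-- In each matrix `Amat b`, the supports of any two distinct rows together contain at least two
column indices. -/
theorem Amat_exists_ne_support (b : Bool × Bool) (i₁ i₂ : Fin 4) (h : i₁ ≠ i₂) :
    ∃ k₁ k₂ : Fin 4, k₁ ≠ k₂ ∧ (Amat b i₁ k₁ ≠ 0 ∨ Amat b i₂ k₁ ≠ 0) ∧
      (Amat b i₁ k₂ ≠ 0 ∨ Amat b i₂ k₂ ≠ 0) := by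
  obtain ⟨_ | _, _ | _⟩ := b <;> fin_cases i₁ <;> fin_cases i₂ <;>
    simp [Amat, Fin.exists_fin_succ] at h ⊢

/-- If a row of a product of natural-number matrices vanishes, so do all rows of the right factor
indexed by the support of the corresponding row of the left factor. -/
theorem Matrix.row_eq_zero_of_mul_row_eq_zero {l m n : Type*} [Fintype m]
    {A : Matrix l m ℕ} {M : Matrix m n ℕ} {i : l} (h : ∀ j, (A * M) i j = 0)
    {k : m} (hk : A i k ≠ 0) (j : n) : M k j = 0 := by
  have hj := h j
  rw [Matrix.mul_apply, Finset.sum_eq_zero_iff] at hj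
  exact (mul_eq_zero.mp (hj k (Finset.mem_univ k))).resolve_left hk

/-- For every nonempty finite word `z` over `B`, the product
`A_z = A_{z_1}⋯A_{z_n}` has at most one zero row. -/
theorem stmt_7 (z : List (Bool × Bool)) (hz : z ≠ []) :
    ∀ i₁ i₂ : Fin 4,
      (∀ j, (z.map Amat).prod i₁ j = 0) →
      (∀ j, (z.map Amat).prod i₂ j = 0) → i₁ = i₂ := by
  clear hz
  induction z with
  | nil =>
    intro i₁ _ h₁ _
    simpa using h₁ i₁
  | cons b z ih =>
    intro i₁ i₂ h₁ h₂
    rw [List.map_cons, List.prod_cons] at h₁ h₂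
    by_contra hne
    obtain ⟨k₁, k₂, hk, hs₁, hs₂⟩ := Amat_exists_ne_support b i₁ i₂ hne
    have hzero {k : Fin 4} (hs : Amat b i₁ k ≠ 0 ∨ Amat b i₂ k ≠ 0) :=
      hs.elim (Matrix.row_eq_zero_of_mul_row_eq_zero h₁) (Matrix.row_eq_zero_of_mul_row_eq_zero h₂)
    exact hk (ih k₁ k₂ (hzero hs₁) (hzero hs₂))
end

section
/- Let d ≥ 2 and let A be a d×d real matrix with nonnegative entries such that every row of A is either strictly positive (all entries > 0) or identically zero, and such that the set S of indices of strictly positive rows has at least 2 elements. Then A is a contraction for the Hilbert metric: there exists a constant 0 ≤ c < 1 such that for all vectors x, y ∈ ℝ^d with all entries strictly positive, log( max_{i∈S} (Ax)_i/(Ay)_i ) − log( min_{i∈S} (Ax)_i/(Ay)_i ) ≤ c · ( log( max_{1≤i≤d} x_i/y_i ) − log( min_{1≤i≤d} x_i/y_i ) ). -/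
/-- Scalar form of the contraction: the averages `P`, `Q` of quantities lying in `[m, M]` have
comparable weights, with comparison constant `ε`. -/
theorem log_sub_log_le_of_comparable {ε m M P Q : ℝ} (hε : 0 < ε) (hε2 : ε ≤ 1 / 2) (hm : 0 < m)
    (hmQ : m ≤ Q) (hmM : m ≤ M) (hP : 0 < P) (hPQ : ε * P ≤ Q) (hgap : ε * (M - Q) ≤ M - P) :
    Real.log P - Real.log Q ≤ (1 - ε ^ 3) * (Real.log M - Real.log m) := by
  have hQ : 0 < Q := hm.trans_le hmQ
  have hM : 0 < M := hm.trans_le hmM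
  rw [← Real.log_div hP.ne' hQ.ne', ← Real.log_div hM.ne' hm.ne']
  set t := M / m with ht
  have ht1 : 1 ≤ t := (one_le_div hm).2 hmM
  have ht0 : 0 < t := one_pos.trans_le ht1
  have hlog : 0 ≤ Real.log t := Real.log_nonneg ht1
  rcases le_total (ε ^ 2 * t) 1 with h | h
  · have hMQ : M ≤ t * Q := by
      rw [ht, div_mul_eq_mul_div, le_div_iff₀ hm]
      gcongr
    have hu : P / Q ≤ t * (1 - ε * (1 - 1 / t)) := by
      have : t * (1 - ε * (1 - 1 / t)) = ε + (1 - ε) * t := by field_simp; ring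
      rw [this, div_le_iff₀ hQ]
      nlinarith
    have hinv : 1 / t ≤ 1 := (div_le_one ht0).2 ht1
    have hinv0 : 0 < 1 / t := by positivity
    have hv : 0 < 1 - ε * (1 - 1 / t) := by nlinarith
    have h1 : Real.log (P / Q) ≤ Real.log t + Real.log (1 - ε * (1 - 1 / t)) := by
      rw [← Real.log_mul ht0.ne' hv.ne']
      exact Real.log_le_log (by positivity) hu
    have h2 := Real.log_le_sub_one_of_pos hv
    have h3 : ε ^ 2 * Real.log t ≤ 1 - 1 / t := by
      have h4 := Real.log_le_sub_one_of_pos ht0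
      have h5 : ε ^ 2 ≤ 1 / t := (le_div_iff₀ ht0).2 h
      calc ε ^ 2 * Real.log t ≤ 1 / t * (t - 1) := by gcongr
        _ = 1 - 1 / t := by field_simp
    nlinarith
  · have hsq : (P / Q) ^ 2 ≤ t := by
      have h1 : ε * (P / Q) ≤ 1 := by
        rw [← mul_div_assoc]
        exact (div_le_one hQ).2 hPQ
      have h2 : (ε * (P / Q)) ^ 2 ≤ 1 := pow_le_one₀ (by positivity) h1
      have h3 : ε ^ 2 * (P / Q) ^ 2 ≤ ε ^ 2 * t := by rw [← mul_pow]; exact h2.trans h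
      exact le_of_mul_le_mul_left h3 (by positivity)
    have h4 := Real.log_le_log (by positivity) hsq
    rw [Real.log_pow] at h4
    push_cast at h4
    have h5 : ε ^ 3 ≤ 1 / 2 := by
      calc ε ^ 3 ≤ (1 / 2) ^ 3 := by gcongr
        _ ≤ 1 / 2 := by norm_num
    nlinarith

/-- Finitely many positive entries have pairwise comparable products, uniformly. -/
theorem exists_comparison_const {ι κ : Type*} [Finite κ] (S : Finset ι) (A : ι → κ → ℝ)
    (hpos : ∀ i ∈ S, ∀ j, 0 < A i j) :
    ∃ ε : ℝ, 0 < ε ∧ ε ≤ 1 / 2 ∧ ∀ i ∈ S, ∀ k ∈ S, ∀ j l,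
      ε * (A k j * A i l) ≤ A i j * A k l := by
  let f : S × S × κ × κ → ℝ := fun p =>
    A p.1 p.2.2.1 * A p.2.1 p.2.2.2 / (A p.2.1 p.2.2.1 * A p.1 p.2.2.2)
  have hf : ∀ p, 0 < f p := fun p =>
    div_pos (mul_pos (hpos _ p.1.2 _) (hpos _ p.2.1.2 _))
      (mul_pos (hpos _ p.2.1.2 _) (hpos _ p.1.2 _))
  obtain ⟨δ, hδ, hδf⟩ : ∃ δ : ℝ, 0 < δ ∧ ∀ p, δ ≤ f p := by
    rcases isEmpty_or_nonempty (S × S × κ × κ) with he | hne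
    · exact ⟨1, one_pos, fun p => he.elim p⟩
    · obtain ⟨p, hp⟩ := Finite.exists_min f
      exact ⟨f p, hf p, hp⟩
  refine ⟨min δ (1 / 2), by positivity, min_le_right _ _, fun i hi k hk j l => ?_⟩
  have h := (min_le_left δ (1 / 2)).trans (hδf (⟨i, hi⟩, ⟨k, hk⟩, j, l))
  exact (le_div_iff₀ (mul_pos (hpos k hk j) (hpos i hi l))).1 h


/-- a `d × d` nonnegative matrix (`d ≥ 2`) whose rows are each either
strictly positive or identically zero, with at least two strictly positive rows
(indexed by `S`), is a uniform contraction for the Hilbert projective metric: there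
is `0 ≤ c < 1` such that for all strictly positive `x, y ∈ ℝ^d`,
`log max_{i∈S} (Ax)_i/(Ay)_i − log min_{i∈S} (Ax)_i/(Ay)_i
  ≤ c (log max_i x_i/y_i − log min_i x_i/y_i)`. -/
theorem stmt_15 (d : ℕ) (hd : 2 ≤ d) (A : Matrix (Fin d) (Fin d) ℝ)
    (hnn : ∀ i j, 0 ≤ A i j)
    (S : Finset (Fin d)) (hS : 2 ≤ S.card)
    (hpos : ∀ i ∈ S, ∀ j, 0 < A i j)
    (hzero : ∀ i ∉ S, ∀ j, A i j = 0) :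
    ∃ c : ℝ, 0 ≤ c ∧ c < 1 ∧
      ∀ x y : Fin d → ℝ, (∀ i, 0 < x i) → (∀ i, 0 < y i) →
        Real.log (S.sup' (Finset.card_pos.mp (by omega))
            fun i => A.mulVec x i / A.mulVec y i)
          - Real.log (S.inf' (Finset.card_pos.mp (by omega))
            fun i => A.mulVec x i / A.mulVec y i)
        ≤ c * (Real.log (Finset.univ.sup' ⟨⟨0, by omega⟩, Finset.mem_univ _⟩
            fun i : Fin d => x i / y i)
          - Real.log (Finset.univ.inf' ⟨⟨0, by omega⟩, Finset.mem_univ _⟩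
            fun i : Fin d => x i / y i)) := by
  have hSne : S.Nonempty := Finset.card_pos.mp (by omega)
  have : NeZero d := ⟨by omega⟩
  obtain ⟨ε, hε, hε2, hA⟩ := exists_comparison_const S A hpos
  refine ⟨1 - ε ^ 3, sub_nonneg.2 (pow_le_one₀ hε.le (by linarith)),
    sub_lt_self _ (by positivity), fun x y hx hy => ?_⟩
  have hmul : ∀ z : Fin d → ℝ, (∀ i, 0 < z i) → ∀ i ∈ S, 0 < A.mulVec z i := fun z hz i hi =>
    Finset.sum_pos (fun j _ => mul_pos (hpos i hi j) (hz j)) Finset.univ_nonempty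
  have hU : (Finset.univ : Finset (Fin d)).Nonempty := Finset.univ_nonempty
  obtain ⟨i, hi, hieq⟩ := Finset.exists_mem_eq_sup' hSne fun i => A.mulVec x i / A.mulVec y i
  obtain ⟨k, hk, hkeq⟩ := Finset.exists_mem_eq_inf' hSne fun i => A.mulVec x i / A.mulVec y i
  rw [hieq, hkeq]
  set M := Finset.univ.sup' hU fun i : Fin d => x i / y i with hMdef
  set m := Finset.univ.inf' hU fun i : Fin d => x i / y i with hmdef
  have hM : ∀ j, x j ≤ M * y j := fun j =>
    (div_le_iff₀ (hy j)).1 (Finset.le_sup' (fun i => x i / y i) (Finset.mem_univ j))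
  have hm : ∀ j, m * y j ≤ x j := fun j =>
    (le_div_iff₀ (hy j)).1 (Finset.inf'_le (fun i => x i / y i) (Finset.mem_univ j))
  have hm0 : 0 < m := (Finset.lt_inf'_iff hU).2 fun j _ => div_pos (hx j) (hy j)
  have hmM : m ≤ M := le_of_mul_le_mul_right ((hm 0).trans (hM 0)) (hy 0)
  have hYi := hmul y hy i hi
  have hYk := hmul y hy k hk
  have hcmp : ∀ i ∈ S, ∀ k ∈ S, ∀ j, ε * A k j * A.mulVec y i ≤ A i j * A.mulVec y k := by
    intro i hi k hk j
    simp only [Matrix.mulVec, dotProduct, Finset.mul_sum]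
    refine Finset.sum_le_sum fun l _ => ?_
    nlinarith [mul_le_mul_of_nonneg_right (hA i hi k hk j l) (hy l).le]
  have hsum : ∀ z : Fin d → ℝ, (∀ j, 0 ≤ z j) → ∀ i ∈ S, ∀ k ∈ S,
      ε * A.mulVec z k * A.mulVec y i ≤ A.mulVec z i * A.mulVec y k := by
    intro z hz i hi k hk
    calc ε * A.mulVec z k * A.mulVec y i = ∑ j, ε * A k j * A.mulVec y i * z j := by
          rw [Matrix.mulVec, dotProduct, Finset.mul_sum, Finset.sum_mul]
          exact Finset.sum_congr rfl fun j _ => by ring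
      _ ≤ ∑ j, A i j * A.mulVec y k * z j :=
          Finset.sum_le_sum fun j _ => mul_le_mul_of_nonneg_right (hcmp i hi k hk j) (hz j)
      _ = A.mulVec z i * A.mulVec y k := by
          conv_rhs => rw [Matrix.mulVec, dotProduct, Finset.sum_mul]
          exact Finset.sum_congr rfl fun j _ => by ring
  refine log_sub_log_le_of_comparable hε hε2 hm0 ?_ hmM (div_pos (hmul x hx i hi) hYi) ?_ ?_
  · rw [le_div_iff₀ hYk, Matrix.mulVec, Matrix.mulVec, dotProduct, dotProduct, Finset.mul_sum]
    refine Finset.sum_le_sum fun j _ => ?_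
    nlinarith [mul_le_mul_of_nonneg_left (hm j) (hpos k hk j).le]
  · rw [← mul_div_assoc, div_le_div_iff₀ hYi hYk]
    exact hsum x (fun j => (hx j).le) k hk i hi
  · have h := hsum (M • y - x) (fun j => sub_nonneg.2 (hM j)) i hi k hk
    simp only [Matrix.mulVec_sub, Matrix.mulVec_smul, Pi.sub_apply, Pi.smul_apply,
      smul_eq_mul] at h
    rw [sub_div' hYk.ne', sub_div' hYi.ne', ← mul_div_assoc, div_le_div_iff₀ hYk hYi]
    exact h
end
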